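/- Consider the H-model with parameter p and suppose θ = θ_NE(1−p) > 0. Then for each N > 0 there exists M > N such that for some A ∈ [N,M], the probability that the event B^O(A,A) occurs with the whole circuit contained in Λ_M \ Λ_N is strictly greater than (1/9)·(θ(1−p)/2)⁸. -/

import Mathlib

open MeasureTheory ENNReal

namespace RandomOrientation

/-- One step of the base-`(p, 1-p)` expansion map on `[0,1)`. -/
noncomputable def expand (p x : ℝ) : ℝ := if x < p then x / p else (x - p) / (1 - p)

/-- The `n`-th digit of the Bernoulli(`p`) expansion of `x`: for `x` uniformly
distributed on `[0,1)` the digits are i.i.d. `{true, false}`-valued with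
`P(true) = p`. -/
noncomputable def bernDigit (p : ℝ) (n : ℕ) (x : ℝ) : Bool :=
  decide ((expand p)^[n] x < p)

/-- The product over the countable index set `I` of Bernoulli(`p`) measures on
`Bool` (`P(true) = p`), realized as the joint distribution of the digits of the
Bernoulli(`p`) expansion of a uniform random point of `[0,1)`. -/
noncomputable def bernoulliProduct (I : Type*) [Encodable I] (p : ℝ) :
    Measure (I → Bool) :=
  Measure.map (fun x i => bernDigit p (Encodable.encode i) x)
    (volume.restrict (Set.Ico (0 : ℝ) 1))

/-- Edges of `ℤ²`: `(v, false)` is the horizontal edge from `v` to `v + (1,0)`,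
`(v, true)` the vertical edge from `v` to `v + (0,1)`. -/
abbrev Edge : Type := (ℤ × ℤ) × Bool

/-- An orientation configuration of the edges of `ℤ²`. -/
abbrev Config : Type := Edge → Bool

def eSrc (e : Edge) : ℤ × ℤ := e.1

def eDst (e : Edge) : ℤ × ℤ := if e.2 then (e.1.1, e.1.2 + 1) else (e.1.1 + 1, e.1.2)

/-- The law of the random orientation with parameter `p`: each edge independently
carries the bit `true` with probability `p`. -/
noncomputable def mu (p : ℝ) : Measure Config := bernoulliProduct Edge p

/-- The directed-edge relation of Grimmett's random-orientation model:
`ω e = true` means the edge `e` is oriented in the positive coordinate direction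
(rightwards resp. upwards), `ω e = false` in the negative one. -/
def gStep (ω : Config) (u v : ℤ × ℤ) : Prop :=
  ∃ e : Edge, (eSrc e = u ∧ eDst e = v ∧ ω e = true) ∨ (eSrc e = v ∧ eDst e = u ∧ ω e = false)

/-- Squared euclidean norm on `ℤ²`. -/
def normSq (v : ℤ × ℤ) : ℤ := v.1 ^ 2 + v.2 ^ 2

/-- The directed-edge relation of the H-model: `ω e = true` means the edge `e` is
oriented away from the origin, i.e. towards its endpoint of larger euclidean norm
(adjacent vertices of `ℤ²` never have equal norms). -/
def hStep (ω : Config) (u v : ℤ × ℤ) : Prop :=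
  ∃ e : Edge, ((eSrc e = u ∧ eDst e = v) ∨ (eSrc e = v ∧ eDst e = u)) ∧
    ω e = decide (normSq u < normSq v)

/-- There is an infinite directed self-avoiding path starting at the origin,
all of whose vertices lie in `S`, for the directed-step relation `R`. -/
def percolates (R : ℤ × ℤ → ℤ × ℤ → Prop) (S : Set (ℤ × ℤ)) : Prop :=
  ∃ γ : ℕ → ℤ × ℤ, γ 0 = (0, 0) ∧ Function.Injective γ ∧
    (∀ n, R (γ n) (γ (n + 1))) ∧ ∀ n, γ n ∈ S

/-- The (closed) North-East quadrant of `ℤ²`. -/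
def NEquad : Set (ℤ × ℤ) := {v | 0 ≤ v.1 ∧ 0 ≤ v.2}

/-- `θ_H(p)`: percolation probability of the H-model with parameter `p`. -/
noncomputable def thetaH (p : ℝ) : ℝ≥0∞ := mu p {ω | percolates (hStep ω) Set.univ}

/-- `θ_NE(p)`: probability of an infinite directed self-avoiding path from the
origin staying in the North-East quadrant, in the random-orientation model. -/
noncomputable def thetaNE (p : ℝ) : ℝ≥0∞ := mu p {ω | percolates (gStep ω) NEquad}

/-- `θ_G(p)`: percolation probability of Grimmett's random-orientation model. -/
noncomputable def thetaG (p : ℝ) : ℝ≥0∞ := mu p {ω | percolates (gStep ω) Set.univ}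

/-- The primal edge `e` is oriented in the positive coordinate direction, for the
H-model configuration `ω` (`ω e = true` means oriented away from the origin). -/
def hPos (ω : Config) (e : Edge) : Prop := ω e = decide (normSq (eSrc e) < normSq (eDst e))

/-- Directed step relation of the dual lattice `ℤ²ᵘ_d`.  The coded dual vertex
`(a, b) : ℤ × ℤ` stands for the point `(a + 1/2, b + 1/2)`.  A dual edge is
oriented in the direction of the *absent* orientation of the primal edge it
crosses, rotated by `π/2`; the dual edge between `(a,b)` and `(a+1,b)` crosses
the primal vertical edge `((a+1, b), true)`, and the dual edge between `(a,b)`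
and `(a,b+1)` crosses the primal horizontal edge `((a, b+1), false)`. -/
def dualStep (ω : Config) (d d' : ℤ × ℤ) : Prop :=
  (d' = (d.1 + 1, d.2) ∧ hPos ω ((d.1 + 1, d.2), true)) ∨
  (d = (d'.1 + 1, d'.2) ∧ ¬hPos ω ((d'.1 + 1, d'.2), true)) ∨
  (d' = (d.1, d.2 + 1) ∧ ¬hPos ω ((d.1, d.2 + 1), false)) ∨
  (d = (d'.1, d'.2 + 1) ∧ hPos ω ((d'.1, d'.2 + 1), false))

/-- The coded dual vertex `d` (i.e. the point `d + (1/2, 1/2)`) lies in the box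
`Λ_m = [-m, m]²`. -/
def inBox (m : ℕ) (d : ℤ × ℤ) : Prop := -(m : ℤ) ≤ d.1 ∧ d.1 < m ∧ -(m : ℤ) ≤ d.2 ∧ d.2 < m

/-- The coded dual vertex lies in the (open) NE quadrant `x > 0, y > 0`. -/
def dualNE (d : ℤ × ℤ) : Prop := 0 ≤ d.1 ∧ 0 ≤ d.2

/-- The coded dual vertex lies in the NW quadrant `x < 0, y > 0`. -/
def dualNW (d : ℤ × ℤ) : Prop := d.1 < 0 ∧ 0 ≤ d.2

/-- The coded dual vertex lies in the SW quadrant `x < 0, y < 0`. -/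
def dualSW (d : ℤ × ℤ) : Prop := d.1 < 0 ∧ d.2 < 0

/-- The coded dual vertex lies in the SE quadrant `x > 0, y < 0`. -/
def dualSE (d : ℤ × ℤ) : Prop := 0 ≤ d.1 ∧ d.2 < 0

/-- `B^O(A, A)` (with `A = a + 1/2`), restricted to `Λ_M \ Λ_N`: there is a closed
directed circuit in the dual lattice `ℤ²ᵘ_d` of the form
`(A, 1/2) → (1/2, B) → (-C, -1/2) → (1/2, -D) → (A, 1/2)` for some `B, C, D > 0`,
where each portion between consecutive axis crossings lies in a single dual
quadrant (NE, then NW, then SW, then SE, returning to the starting point), and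
the whole circuit lies in `Λ_M \ Λ_N`. -/
def BOcircuit (N M a : ℕ) (ω : Config) : Prop :=
  ∃ (γ : ℕ → ℤ × ℤ) (L t₁ t₂ t₃ : ℕ), t₁ < t₂ ∧ t₂ < t₃ ∧ t₃ < L ∧
    γ 0 = ((a : ℤ), 0) ∧ γ L = ((a : ℤ), 0) ∧
    (∀ i < L, dualStep ω (γ i) (γ (i + 1))) ∧
    (∀ i ≤ L, inBox M (γ i) ∧ ¬inBox N (γ i)) ∧
    (∀ i ≤ t₁, dualNE (γ i)) ∧
    (∀ i, t₁ < i → i ≤ t₂ → dualNW (γ i)) ∧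
    (∀ i, t₂ < i → i ≤ t₃ → dualSW (γ i)) ∧
    (∀ i, t₃ < i → i < L → dualSE (γ i))

/-- The Bernoulli(`p`) measure on `Bool`. -/
noncomputable def ber (p : ℝ) : Measure Bool :=
  ENNReal.ofReal p • Measure.dirac true + ENNReal.ofReal (1 - p) • Measure.dirac false

open Classical in
lemma ber_apply (p : ℝ) (s : Set Bool) : ber p s =
    (if true ∈ s then ENNReal.ofReal p else 0) +
      (if false ∈ s then ENNReal.ofReal (1 - p) else 0) := by
  simp [ber, Set.indicator_apply]

lemma isProbabilityMeasure_ber {p : ℝ} (h0 : 0 ≤ p) (h1 : p ≤ 1) :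
    IsProbabilityMeasure (ber p) := by
  constructor
  rw [ber_apply]
  simp [← ENNReal.ofReal_add h0 (sub_nonneg.2 h1)]

lemma measurable_expand (p : ℝ) : Measurable (expand p) := by
  unfold expand
  exact Measurable.ite measurableSet_Iio (by fun_prop) (by fun_prop)

lemma measurable_bernDigit (p : ℝ) (n : ℕ) : Measurable (bernDigit p n) := by
  unfold bernDigit
  refine measurable_to_bool ?_
  have : (fun x => decide ((expand p)^[n] x < p)) ⁻¹' {true} = (expand p)^[n] ⁻¹' Set.Iio p := by
    ext x; simp
  rw [this]
  exact (measurable_expand p).iterate n measurableSet_Iio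

lemma volume_Ico_left_inter_expand {p : ℝ} (h0 : 0 ≤ p) (S : Set ℝ) :
    volume (Set.Ico 0 p ∩ expand p ⁻¹' S) =
      ENNReal.ofReal p * volume (Set.Ico 0 1 ∩ S) := by
  rcases h0.eq_or_lt with rfl | h0
  · simp
  have : Set.Ico 0 p ∩ expand p ⁻¹' S = (p⁻¹ * ·) ⁻¹' (Set.Ico 0 1 ∩ S) := by
    ext x
    simp only [Set.mem_inter_iff, Set.mem_Ico, Set.mem_preimage, expand]
    have e : p⁻¹ * x = x / p := by ring
    rw [e, div_lt_one h0]
    constructor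
    · rintro ⟨⟨a, b⟩, c⟩
      rw [if_pos b] at c
      exact ⟨⟨by positivity, b⟩, c⟩
    · rintro ⟨⟨a, b⟩, c⟩
      rw [if_pos b]
      refine ⟨⟨?_, b⟩, c⟩
      by_contra! hx
      exact absurd (div_neg_of_neg_of_pos hx h0) (not_lt.2 a)
  rw [this, Real.volume_preimage_mul_left (inv_ne_zero h0.ne')]
  simp [abs_of_pos h0]

lemma volume_Ico_right_inter_expand {p : ℝ} (h1 : p ≤ 1) (S : Set ℝ) :
    volume (Set.Ico p 1 ∩ expand p ⁻¹' S) =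
      ENNReal.ofReal (1 - p) * volume (Set.Ico 0 1 ∩ S) := by
  rcases h1.eq_or_lt with rfl | h1
  · simp
  have h0 : 0 < 1 - p := by linarith
  have : Set.Ico p 1 ∩ expand p ⁻¹' S =
      (fun x => x + -p) ⁻¹' (((1 - p)⁻¹ * ·) ⁻¹' (Set.Ico 0 1 ∩ S)) := by
    ext x
    simp only [Set.mem_inter_iff, Set.mem_Ico, Set.mem_preimage, expand]
    have e : (1 - p)⁻¹ * (x + -p) = (x - p) / (1 - p) := by ring
    rw [e, div_lt_one h0]
    constructor
    · rintro ⟨⟨a, b⟩, c⟩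
      rw [if_neg (not_lt.2 a)] at c
      exact ⟨⟨div_nonneg (by linarith) h0.le, by linarith⟩, c⟩
    · rintro ⟨⟨a, b⟩, c⟩
      have hx : p ≤ x := by
        by_contra! hx
        exact absurd (div_neg_of_neg_of_pos (sub_neg.2 hx) h0) (not_lt.2 a)
      rw [if_neg (not_lt.2 hx)]
      exact ⟨⟨hx, by linarith⟩, c⟩
  rw [this, measure_preimage_add_right, Real.volume_preimage_mul_left (inv_ne_zero h0.ne')]
  simp [abs_of_pos h0]

lemma volume_bernDigit_zero_inter_expand {p : ℝ} (h0 : 0 ≤ p) (h1 : p ≤ 1) (t : Set Bool)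
    (S : Set ℝ) :
    volume (Set.Ico 0 1 ∩ ({x | bernDigit p 0 x ∈ t} ∩ expand p ⁻¹' S)) =
      ber p t * volume (Set.Ico 0 1 ∩ S) := by
  rw [← measure_inter_add_sdiff _ (measurableSet_Iio (a := p)), ber_apply, add_mul]
  congr 1
  · by_cases ht : true ∈ t
    · rw [if_pos ht, ← volume_Ico_left_inter_expand h0]
      congr 1
      ext x
      simp only [Set.mem_inter_iff, Set.mem_Ico, Set.mem_preimage, Set.mem_ofPred_eq, bernDigit,
        Set.mem_Iio, Function.iterate_zero, id]
      constructor
      · rintro ⟨⟨⟨a, b⟩, c, d⟩, e⟩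
        exact ⟨⟨a, e⟩, d⟩
      · rintro ⟨⟨a, b⟩, c⟩
        exact ⟨⟨⟨a, b.trans_le h1⟩, by simpa [b] using ht, c⟩, b⟩
    · rw [if_neg ht, zero_mul]
      convert measure_empty (μ := (volume : Measure ℝ))
      ext x
      simp only [Set.mem_inter_iff, Set.mem_Ico, Set.mem_preimage, Set.mem_ofPred_eq, bernDigit,
        Set.mem_Iio, Function.iterate_zero, id, Set.mem_empty_iff_false, iff_false]
      rintro ⟨⟨⟨a, b⟩, c, d⟩, e⟩
      simp [e, ht] at c
  · by_cases ht : false ∈ t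
    · rw [if_pos ht, ← volume_Ico_right_inter_expand h1]
      congr 1
      ext x
      simp only [Set.mem_inter_iff, Set.mem_Ico, Set.mem_preimage, Set.mem_ofPred_eq, bernDigit,
        Set.mem_Iio, Function.iterate_zero, id, Set.mem_sdiff, not_lt]
      constructor
      · rintro ⟨⟨⟨a, b⟩, c, d⟩, e⟩
        exact ⟨⟨e, b⟩, d⟩
      · rintro ⟨⟨a, b⟩, c⟩
        exact ⟨⟨⟨h0.trans a, b⟩, by simpa [not_lt.2 a] using ht, c⟩, a⟩
    · rw [if_neg ht, zero_mul]
      convert measure_empty (μ := (volume : Measure ℝ))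
      ext x
      simp only [Set.mem_inter_iff, Set.mem_Ico, Set.mem_preimage, Set.mem_ofPred_eq, bernDigit,
        Set.mem_Iio, Function.iterate_zero, id, Set.mem_empty_iff_false, iff_false, Set.mem_sdiff,
        not_lt]
      rintro ⟨⟨⟨a, b⟩, c, d⟩, e⟩
      simp [not_lt.2 e, ht] at c

lemma volume_bernDigit_prefix {p : ℝ} (h0 : 0 ≤ p) (h1 : p ≤ 1) (n : ℕ) (t : ℕ → Set Bool) :
    volume (Set.Ico 0 1 ∩ {x | ∀ k < n, bernDigit p k x ∈ t k}) =
      ∏ k ∈ Finset.range n, ber p (t k) := by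
  induction n generalizing t with
  | zero => simp
  | succ n ih =>
    rw [Finset.prod_range_succ', ← ih fun k => t (k + 1), mul_comm,
      ← volume_bernDigit_zero_inter_expand h0 h1]
    congr 1
    ext x
    simp only [Set.mem_inter_iff, Set.mem_preimage, Set.mem_ofPred_eq]
    refine and_congr_right fun _ => ?_
    have e : ∀ k, bernDigit p k (expand p x) = bernDigit p (k + 1) x := fun k => rfl
    simp only [e]
    constructor
    · intro h
      exact ⟨h 0 (by omega), fun k hk => h (k + 1) (by omega)⟩
    · rintro ⟨h, h'⟩ k hk
      cases k with
      | zero => exact h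
      | succ k => exact h' k (by omega)

lemma mu_eq_infinitePi {p : ℝ} (h0 : 0 ≤ p) (h1 : p ≤ 1) :
    mu p = Measure.infinitePi (fun _ : Edge => ber p) := by
  classical
  have := isProbabilityMeasure_ber h0 h1
  refine Measure.eq_infinitePi _ fun s t ht => ?_
  have hm : Measurable fun (x : ℝ) (i : Edge) => bernDigit p (Encodable.encode i) x :=
    measurable_pi_lambda _ fun i => measurable_bernDigit p _
  rw [mu, bernoulliProduct, Measure.map_apply hm (.pi s.countable_toSet fun i _ => ht i),
    Measure.restrict_apply (hm (.pi s.countable_toSet fun i _ => ht i)), Set.inter_comm]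
  let e : Edge ↪ ℕ := ⟨Encodable.encode, Encodable.encode_injective⟩
  let t' : ℕ → Set Bool := fun k => {b | ∀ i ∈ s, Encodable.encode i = k → b ∈ t i}
  have ht' : ∀ i ∈ s, t' (Encodable.encode i) = t i := by
    intro i hi
    ext b
    constructor
    · intro h
      exact h i hi rfl
    · intro h j hj hij
      rwa [Encodable.encode_injective hij]
  obtain ⟨n, hn⟩ : ∃ n, ∀ i ∈ s, Encodable.encode i < n := by
    refine ⟨(s.map e).sup id + 1, fun i hi => Nat.lt_succ_of_le ?_⟩
    exact Finset.le_sup (f := id) (Finset.mem_map_of_mem e hi)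
  have := volume_bernDigit_prefix h0 h1 n t'
  rw [← Finset.prod_subset (s₁ := s.map e), Finset.prod_map] at this
  · rw [← Finset.prod_congr rfl fun i hi => congrArg (ber p) (ht' i hi)]
    refine Eq.trans (congrArg _ ?_) this
    ext x
    simp only [Set.mem_inter_iff, Set.mem_preimage, Set.mem_pi, Set.mem_ofPred_eq, t']
    refine and_congr_right fun _ => ⟨?_, ?_⟩
    · rintro h k hk i hi rfl
      exact h i hi
    · intro h i hi
      exact h _ (hn i hi) i hi rfl
  · intro k hk
    obtain ⟨i, hi, rfl⟩ := Finset.mem_map.1 hk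
    exact Finset.mem_range.2 (hn i hi)
  · intro k _ hk
    have : t' k = Set.univ := by
      refine Set.eq_univ_of_forall fun b i hi hik => ?_
      exact absurd (Finset.mem_map.2 ⟨i, hi, hik⟩) hk
    rw [this, measure_univ]

lemma isProbabilityMeasure_mu {p : ℝ} (h0 : 0 ≤ p) (h1 : p ≤ 1) :
    IsProbabilityMeasure (mu p) := by
  have := isProbabilityMeasure_ber h0 h1
  rw [mu_eq_infinitePi h0 h1]
  infer_instance

lemma mu_reindex {p : ℝ} (h0 : 0 ≤ p) (h1 : p ≤ 1) {φ : Edge → Edge}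
    (hφ : Function.Injective φ) {E : Set Config} (hE : MeasurableSet E) :
    mu p {ω | (fun e => ω (φ e)) ∈ E} = mu p E := by
  have := isProbabilityMeasure_ber h0 h1
  rw [mu_eq_infinitePi h0 h1]
  have := Measure.map_infinitePi_infinitePi_of_inj (P := fun _ : Edge => ber p) hφ
  conv_rhs => rw [← this]
  rw [Measure.map_apply (by fun_prop) hE]
  rfl

lemma ber_map_not (p : ℝ) : (ber p).map (!·) = ber (1 - p) := by
  ext s hs
  rw [Measure.map_apply (measurable_of_finite _) hs, ber_apply, ber_apply, add_comm]
  rw [_root_.sub_sub_cancel]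
  rfl

lemma mu_reindex_not {p : ℝ} (h0 : 0 ≤ p) (h1 : p ≤ 1) {φ : Edge → Edge}
    (hφ : Function.Injective φ) {E : Set Config} (hE : MeasurableSet E) :
    mu p {ω | (fun e => !ω (φ e)) ∈ E} = mu (1 - p) E := by
  have := isProbabilityMeasure_ber h0 h1
  have hn : Measurable fun (ω : Config) e => !ω e :=
    measurable_pi_lambda _ fun e => (measurable_of_finite Bool.not).comp (measurable_pi_apply e)
  have := mu_reindex h0 h1 hφ (hn hE)
  refine this.trans ?_
  rw [mu_eq_infinitePi h0 h1, mu_eq_infinitePi (p := 1 - p) (by linarith) (by linarith),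
    ← ber_map_not, ← Measure.infinitePi_map_pi (fun _ : Edge => ber p)
      (f := fun _ b => !b) (fun _ => measurable_of_finite _), Measure.map_apply hn hE]

/-- `E` is determined by the restriction of the configuration to `F`. -/
def DetBy (F : Set Edge) (E : Set Config) : Prop :=
  ∀ ω ω' : Config, (∀ e ∈ F, ω e = ω' e) → ω ∈ E → ω' ∈ E

lemma DetBy.mono {F F' : Set Edge} {E : Set Config} (h : DetBy F E) (hF : F ⊆ F') :
    DetBy F' E :=
  fun ω ω' hω => h ω ω' fun e he => hω e (hF he)

lemma DetBy.inter {F F' : Set Edge} {E E' : Set Config} (h : DetBy F E) (h' : DetBy F' E') :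
    DetBy (F ∪ F') (E ∩ E') :=
  fun ω ω' hω hE => ⟨h ω ω' (fun e he => hω e (Or.inl he)) hE.1,
    h' ω ω' (fun e he => hω e (Or.inr he)) hE.2⟩

open Classical in
/-- Extension of a configuration on `F` by `false`. -/
noncomputable def extend {F : Finset Edge} (η : F → Bool) : Config :=
  fun e => if h : e ∈ F then η ⟨e, h⟩ else false

lemma extend_restrict {F : Finset Edge} {ω : Config} {e : Edge} (he : e ∈ F) :
    extend (F.restrict ω) e = ω e := by
  simp [extend, he]

lemma extend_apply {F : Finset Edge} (η : F → Bool) (e : F) : extend η e = η e := by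
  simp [extend]

lemma DetBy.eq_preimage {F : Finset Edge} {E : Set Config} (h : DetBy F E) :
    E = F.restrict ⁻¹' {η | extend η ∈ E} := by
  ext ω
  constructor
  · exact h _ _ fun e he => (extend_restrict he).symm
  · exact h _ _ fun e he => extend_restrict he

lemma DetBy.measurableSet {F : Finset Edge} {E : Set Config} (h : DetBy F E) :
    MeasurableSet E := by
  rw [h.eq_preimage]
  exact Finset.measurable_restrict F (Set.toFinite _).measurableSet

lemma mu_inter {p : ℝ} (h0 : 0 ≤ p) (h1 : p ≤ 1) {F F' : Finset Edge} (hF : Disjoint F F')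
    {E E' : Set Config} (hE : DetBy F E) (hE' : DetBy F' E') :
    mu p (E ∩ E') = mu p E * mu p E' := by
  have := isProbabilityMeasure_ber h0 h1
  rw [mu_eq_infinitePi h0 h1, hE.eq_preimage, hE'.eq_preimage]
  have := (ProbabilityTheory.iIndepFun_infinitePi (P := fun _ : Edge => ber p)
    (X := fun _ b => b) (fun _ => measurable_id)).indepFun_finset F F' hF
      (fun i => measurable_pi_apply i)
  exact this.measure_inter_preimage_eq_mul _ _ (Set.toFinite _).measurableSet
    (Set.toFinite _).measurableSet

lemma mu_apply_true {p : ℝ} (h0 : 0 ≤ p) (h1 : p ≤ 1) (e : Edge) :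
    mu p {ω | ω e = true} = ENNReal.ofReal p := by
  have := isProbabilityMeasure_ber h0 h1
  have := Measure.infinitePi_map_eval (fun _ : Edge => ber p) e
  rw [mu_eq_infinitePi h0 h1]
  have h2 := congrArg (fun m => m {true}) this
  rw [Measure.map_apply (measurable_pi_apply e) (measurableSet_singleton true), ber_apply] at h2
  refine Eq.trans (congrArg _ ?_) (h2.trans ?_)
  · rfl
  · simp

lemma mu_apply_false {p : ℝ} (h0 : 0 ≤ p) (h1 : p ≤ 1) (e : Edge) :
    mu p {ω | ω e = false} = ENNReal.ofReal (1 - p) := by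
  have := isProbabilityMeasure_ber h0 h1
  have := Measure.infinitePi_map_eval (fun _ : Edge => ber p) e
  rw [mu_eq_infinitePi h0 h1]
  have h2 := congrArg (fun m => m {false}) this
  rw [Measure.map_apply (measurable_pi_apply e) (measurableSet_singleton false), ber_apply] at h2
  refine Eq.trans (congrArg _ ?_) (h2.trans ?_)
  · rfl
  · simp

/-- The weight of a bit under Bernoulli(`q`). -/
def bitWeight (q : ℝ) (b : Bool) : ℝ := if b then q else 1 - q

open Classical in
lemma mu_toReal_eq_sum {p : ℝ} (h0 : 0 ≤ p) (h1 : p ≤ 1) {F : Finset Edge} {E : Set Config}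
    (hE : DetBy F E) :
    (mu p E).toReal =
      ∑ η : F → Bool, (∏ e, bitWeight p (η e)) * (if extend η ∈ E then 1 else 0) := by
  have := isProbabilityMeasure_ber h0 h1
  have h2 : mu p E = Measure.pi (fun _ : F => ber p) {η | extend η ∈ E} := by
    conv_lhs => rw [mu_eq_infinitePi h0 h1, hE.eq_preimage]
    exact Measure.infinitePi_cylinder (fun _ : Edge => ber p) (Set.toFinite _).measurableSet
  have h3 : {η : F → Bool | extend η ∈ E} =
      ((Finset.univ.filter fun η : F → Bool => extend η ∈ E : Finset (F → Bool)) : Set _) := by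
    simp
  rw [h2, h3, ← sum_measure_singleton, ENNReal.toReal_sum (fun _ _ => measure_ne_top _ _),
    Finset.sum_filter]
  refine Finset.sum_congr rfl fun η _ => ?_
  by_cases h : extend η ∈ E
  · rw [if_pos h, if_pos h, mul_one, Measure.pi_singleton, ENNReal.toReal_prod]
    refine Finset.prod_congr rfl fun e _ => ?_
    rw [ber_apply]
    cases η e <;> simp [bitWeight, h0, h1]
  · simp [h]

open Relation

section OneEdge

variable {V : Type*} {r : V → V → Prop} {u v a b c : V}

lemma reflTransGen_add_edge (h : ReflTransGen (fun x y => r x y ∨ (x = u ∧ y = v)) a b) :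
    ReflTransGen r a b ∨ (ReflTransGen r a u ∧ ReflTransGen r v b) := by
  induction h with
  | refl => exact Or.inl .refl
  | tail _ hs ih =>
    rcases hs with hs | ⟨rfl, rfl⟩
    · exact ih.imp (·.tail hs) (fun h => ⟨h.1, h.2.tail hs⟩)
    · exact Or.inr ⟨ih.elim id (·.1), .refl⟩

lemma reflTransGen_add_both (h : ReflTransGen
      (fun x y => r x y ∨ (x = u ∧ y = v) ∨ (x = v ∧ y = u)) a b) :
    ReflTransGen (fun x y => r x y ∨ (x = u ∧ y = v)) a b ∨
      ReflTransGen (fun x y => r x y ∨ (x = v ∧ y = u)) a b := by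
  have hl : ∀ {u v x y : V}, ReflTransGen r x y →
      ReflTransGen (fun x y => r x y ∨ (x = u ∧ y = v)) x y :=
    fun h => ReflTransGen.mono (fun _ _ => Or.inl) _ _ h
  induction h with
  | refl => exact Or.inl .refl
  | tail _ hs ih =>
    rcases hs with hs | ⟨rfl, rfl⟩ | ⟨rfl, rfl⟩
    · exact ih.imp (·.tail (Or.inl hs)) (·.tail (Or.inl hs))
    · left
      rcases ih with ih | ih
      · exact ih.tail (Or.inr ⟨rfl, rfl⟩)
      · rcases reflTransGen_add_edge ih with h | h
        · exact (hl h).tail (Or.inr ⟨rfl, rfl⟩)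
        · exact hl h.1
    · right
      rcases ih with ih | ih
      · rcases reflTransGen_add_edge ih with h | h
        · exact (hl h).tail (Or.inr ⟨rfl, rfl⟩)
        · exact hl h.1
      · exact ih.tail (Or.inr ⟨rfl, rfl⟩)

end OneEdge

section Independent

variable {ι V : Type*}

/-- The step relation when each edge `i` from `s i` to `t i` is open forwards if `(η i).1`
and open backwards if `(η i).2`. -/
def biStep (s t : ι → V) (η : ι → Bool × Bool) (x y : V) : Prop :=
  ∃ i, (s i = x ∧ t i = y ∧ (η i).1 = true) ∨ (s i = y ∧ t i = x ∧ (η i).2 = true)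

/-- Some vertex of `B` can be reached from some vertex of `A`. -/
def BiConn (s t : ι → V) (A B : Set V) (η : ι → Bool × Bool) : Prop :=
  ∃ a ∈ A, ∃ b ∈ B, ReflTransGen (biStep s t η) a b

variable {s t : ι → V} {A B : Set V} {η η' : ι → Bool × Bool}

lemma BiConn.mono (h : η ≤ η') (hη : BiConn s t A B η) : BiConn s t A B η' := by
  obtain ⟨a, ha, b, hb, hab⟩ := hη
  refine ⟨a, ha, b, hb, ReflTransGen.mono ?_ _ _ hab⟩
  rintro x y ⟨i, hi⟩
  refine ⟨i, hi.imp (fun h' => ⟨h'.1, h'.2.1, ?_⟩) (fun h' => ⟨h'.1, h'.2.1, ?_⟩)⟩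
  · exact (h i).1 h'.2.2
  · exact (h i).2 h'.2.2

variable [DecidableEq ι]

lemma biStep_update (i : ι) (x y : Bool) :
    biStep s t (Function.update η i (x, y)) = fun a b =>
      biStep s t (Function.update η i (false, false)) a b ∨
        (a = s i ∧ b = t i ∧ x = true) ∨ (a = t i ∧ b = s i ∧ y = true) := by
  ext a b
  constructor
  · rintro ⟨j, hj⟩
    by_cases hji : j = i
    · subst hji
      right
      simp only [Function.update_self] at hj
      exact hj.imp (fun h => ⟨h.1.symm, h.2.1.symm, h.2.2⟩) (fun h => ⟨h.2.1.symm, h.1.symm, h.2.2⟩)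
    · left
      rw [Function.update_of_ne hji] at hj
      exact ⟨j, by rwa [Function.update_of_ne hji]⟩
  · rintro (⟨j, hj⟩ | ⟨rfl, rfl, h⟩ | ⟨rfl, rfl, h⟩)
    · by_cases hji : j = i
      · subst hji
        simp at hj
      · rw [Function.update_of_ne hji] at hj
        exact ⟨j, by rwa [Function.update_of_ne hji]⟩
    · exact ⟨i, Or.inl ⟨rfl, rfl, by simpa⟩⟩
    · exact ⟨i, Or.inr ⟨rfl, rfl, by simpa⟩⟩

lemma biConn_update_both (i : ι) (h : BiConn s t A B (Function.update η i (true, true))) :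
    BiConn s t A B (Function.update η i (true, false)) ∨
      BiConn s t A B (Function.update η i (false, true)) := by
  obtain ⟨a, ha, b, hb, hab⟩ := h
  rw [biStep_update] at hab
  simp only [and_true] at hab
  refine (reflTransGen_add_both hab).imp (fun h => ⟨a, ha, b, hb, ?_⟩)
    (fun h => ⟨a, ha, b, hb, ?_⟩) <;> rw [biStep_update] <;> simpa using h

lemma biConn_update_none (i : ι) (h : BiConn s t A B (Function.update η i (true, false)))
    (h' : BiConn s t A B (Function.update η i (false, true))) :
    BiConn s t A B (Function.update η i (false, false)) := by
  obtain ⟨a, ha, b, hb, hab⟩ := h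
  obtain ⟨a', ha', b', hb', hab'⟩ := h'
  rw [biStep_update] at hab hab'
  simp only [and_true, Bool.false_eq_true, and_false, or_false, false_or] at hab hab'
  rcases reflTransGen_add_edge hab with h | h
  · exact ⟨a, ha, b, hb, h⟩
  rcases reflTransGen_add_edge hab' with h' | h'
  · exact ⟨a', ha', b', hb', h'⟩
  exact ⟨a, ha, b', hb', h.1.trans h'.2⟩

open Classical in
/-- The indicator of `BiConn`. -/
noncomputable def biInd (s t : ι → V) (A B : Set V) (η : ι → Bool × Bool) : ℝ :=
  if BiConn s t A B η then 1 else 0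

lemma biInd_update (i : ι) :
    biInd s t A B (Function.update η i (true, true)) +
      biInd s t A B (Function.update η i (false, false)) =
    biInd s t A B (Function.update η i (true, false)) +
      biInd s t A B (Function.update η i (false, true)) := by
  have h1 := biConn_update_both (s := s) (t := t) (A := A) (B := B) (η := η) i
  have h2 := biConn_update_none (s := s) (t := t) (A := A) (B := B) (η := η) i
  have m : ∀ {x y : Bool × Bool}, x ≤ y → BiConn s t A B (Function.update η i x) →
      BiConn s t A B (Function.update η i y) :=
    fun h => BiConn.mono (update_le_update_iff.2 ⟨h, fun _ _ => le_rfl⟩)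
  have m1 := @m (false, false) (true, false) (by decide)
  have m2 := @m (false, false) (false, true) (by decide)
  have m3 := @m (true, false) (true, true) (by decide)
  have m4 := @m (false, true) (true, true) (by decide)
  clear m
  unfold biInd
  generalize BiConn s t A B (Function.update η i (true, true)) = a at *
  generalize BiConn s t A B (Function.update η i (true, false)) = b at *
  generalize BiConn s t A B (Function.update η i (false, true)) = c at *
  generalize BiConn s t A B (Function.update η i (false, false)) = d at *
  by_cases hb : b <;> by_cases hc : c
  · simp [hb, hc, m3 hb, h2 hb hc]
  · simp [hb, hc, m3 hb, mt m2 hc]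
  · simp [hb, hc, m4 hc, mt m1 hb]
  · have ha : ¬a := fun ha => (h1 ha).elim hb hc
    simp [hb, hc, ha, mt m1 hb]

end Independent

section Swap

variable {ι β : Type*} [Fintype ι] [DecidableEq ι] [Fintype β]

lemma sum_prod_mul_eq_split (i : ι) (w : ι → β → ℝ) (f : (ι → β) → ℝ) :
    ∑ η : ι → β, (∏ j, w j (η j)) * f η =
      ∑ ζ : {j // j ≠ i} → β, (∏ j : {j // j ≠ i}, w j (ζ j)) *
        ∑ x, w i x * f ((Equiv.funSplitAt i β).symm (x, ζ)) := by
  rw [← (Equiv.funSplitAt i β).symm.sum_comp, Fintype.sum_prod_type, Finset.sum_comm]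
  refine Finset.sum_congr rfl fun ζ _ => ?_
  rw [Finset.mul_sum]
  refine Finset.sum_congr rfl fun x _ => ?_
  rw [← mul_assoc, Fintype.prod_eq_mul_prod_subtype_ne _ i, mul_comm (w i _)]
  congr 2
  · refine Finset.prod_congr rfl fun j _ => ?_
    simp [j.2]
  · simp

lemma sum_prod_mul_congr {w w' : ι → β → ℝ} {f : (ι → β) → ℝ}
    (h : ∀ (i : ι) (η : ι → β), ∑ x, w i x * f (Function.update η i x) =
      ∑ x, w' i x * f (Function.update η i x)) :
    ∑ η : ι → β, (∏ j, w j (η j)) * f η = ∑ η : ι → β, (∏ j, w' j (η j)) * f η := by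
  suffices H : ∀ S : Finset ι, ∑ η : ι → β, (∏ j, w j (η j)) * f η =
      ∑ η : ι → β, (∏ j, (if j ∈ S then w' j else w j) (η j)) * f η by
    simpa using H Finset.univ
  intro S
  induction S using Finset.induction_on with
  | empty => simp
  | insert i S hi ih =>
    rw [ih, sum_prod_mul_eq_split i, sum_prod_mul_eq_split i]
    refine Finset.sum_congr rfl fun ζ _ => ?_
    congr 1
    · refine Finset.prod_congr rfl fun j _ => ?_
      simp [Finset.mem_insert, j.2]
    · rcases isEmpty_or_nonempty β with hβ | ⟨⟨y⟩⟩
      · simp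
      have e : ∀ x, (Equiv.funSplitAt i β).symm (x, ζ) =
          Function.update ((Equiv.funSplitAt i β).symm (y, ζ)) i x := by
        intro x
        ext j
        by_cases hj : j = i
        · subst hj; simp
        · simp [hj]
      rw [if_neg hi, if_pos (Finset.mem_insert_self i S)]
      have h' := h i ((Equiv.funSplitAt i β).symm (y, ζ))
      rwa [← Finset.sum_congr rfl fun x _ => congrArg (w i x * ·) (congrArg f (e x)),
        ← Finset.sum_congr rfl fun x _ => congrArg (w' i x * ·) (congrArg f (e x))] at h'

end Swap

/-- Directed steps along the edges of `F` in the orientation `ω`. -/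
def stp (F : Set Edge) (ω : Config) (u v : ℤ × ℤ) : Prop :=
  ∃ e ∈ F, (eSrc e = u ∧ eDst e = v ∧ ω e = true) ∨ (eSrc e = v ∧ eDst e = u ∧ ω e = false)

/-- Some vertex of `B` can be reached from some vertex of `A` along edges of `F`. -/
def Conn (F : Set Edge) (A B : Set (ℤ × ℤ)) : Set Config :=
  {ω | ∃ a ∈ A, ∃ b ∈ B, ReflTransGen (stp F ω) a b}

lemma detBy_conn (F : Set Edge) (A B : Set (ℤ × ℤ)) : DetBy F (Conn F A B) := by
  rintro ω ω' h ⟨a, ha, b, hb, hab⟩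
  refine ⟨a, ha, b, hb, ReflTransGen.mono ?_ _ _ hab⟩
  rintro x y ⟨e, he, h'⟩
  exact ⟨e, he, by rwa [← h e he]⟩

/-- Weights of the states of an edge with a single orientation. -/
noncomputable def orientWeight (q : ℝ) (x : Bool × Bool) : ℝ :=
  if x.2 = !x.1 then bitWeight q x.1 else 0

/-- Weights of the states of an edge whose two directions are open independently. -/
noncomputable def indepWeight (q : ℝ) (x : Bool × Bool) : ℝ :=
  bitWeight q x.1 * bitWeight (1 - q) x.2

lemma mu_conn_toReal {q : ℝ} (h0 : 0 ≤ q) (h1 : q ≤ 1) (F : Finset Edge) (A B : Set (ℤ × ℤ)) :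
    (mu q (Conn F A B)).toReal = ∑ η : F → Bool × Bool, (∏ e, indepWeight q (η e)) *
      biInd (fun e : F => eSrc e) (fun e : F => eDst e) A B η := by
  classical
  rw [mu_toReal_eq_sum h0 h1 (detBy_conn F A B)]
  have key : ∑ η : F → Bool, (∏ e, bitWeight q (η e)) *
      (if extend η ∈ Conn F A B then (1 : ℝ) else 0) =
      ∑ η : F → Bool × Bool, (∏ e, orientWeight q (η e)) *
        biInd (fun e : F => eSrc e) (fun e : F => eDst e) A B η := by
    refine Finset.sum_of_injOn (fun η e => (η e, !η e)) ?_ (by simp) ?_ ?_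
    · intro η _ η' _ h
      ext e
      exact congrArg Prod.fst (congrFun h e)
    · intro η _ hη
      obtain ⟨e, he⟩ : ∃ e, (η e).2 ≠ !(η e).1 := by
        by_contra! hc
        refine hη ⟨fun e => (η e).1, by simp, ?_⟩
        ext e
        · rfl
        · simp [hc e]
      rw [Finset.prod_eq_zero (Finset.mem_univ e), zero_mul]
      simp [orientWeight, he]
    · intro η _
      congr 1
      · simp [orientWeight]
      · unfold biInd
        refine if_congr ?_ rfl rfl
        unfold Conn BiConn
        have : stp F (extend η) = biStep (fun e : F => eSrc e) (fun e : F => eDst e)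
            (fun e => (η e, !η e)) := by
          ext x y
          constructor
          · rintro ⟨e, he, h⟩
            refine ⟨⟨e, he⟩, ?_⟩
            simpa [extend_apply η ⟨e, he⟩] using h
          · rintro ⟨e, h⟩
            exact ⟨e, e.2, by simpa [extend_apply η e] using h⟩
        rw [← this]
        rfl
  rw [key]
  refine sum_prod_mul_congr fun i η => ?_
  have := biInd_update (s := fun e : F => eSrc e) (t := fun e : F => eDst e) (A := A) (B := B)
    (η := η) i
  simp only [Fintype.sum_prod_type, Fintype.sum_bool, orientWeight, indepWeight, bitWeight]
  simp
  linear_combination (q ^ 2 - q) * this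

lemma bitWeight_nonneg {q : ℝ} (h0 : 0 ≤ q) (h1 : q ≤ 1) (b : Bool) : 0 ≤ bitWeight q b := by
  cases b <;> simp [bitWeight, h0, h1]

lemma sum_prod_indepWeight (q : ℝ) (F : Finset Edge) :
    ∑ η : F → Bool × Bool, ∏ e, indepWeight q (η e) = 1 := by
  classical
  rw [← Fintype.prod_sum]
  refine Finset.prod_eq_one fun e _ => ?_
  simp [Fintype.sum_prod_type, indepWeight, bitWeight]
  ring

lemma indepWeight_mul (q : ℝ) (a b : Bool × Bool) :
    indepWeight q a * indepWeight q b = indepWeight q (a ⊓ b) * indepWeight q (a ⊔ b) := by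
  rcases a with ⟨_ | _, _ | _⟩ <;> rcases b with ⟨_ | _, _ | _⟩ <;>
    simp [indepWeight, bitWeight] <;> ring

lemma mu_conn_mul_le {q : ℝ} (h0 : 0 ≤ q) (h1 : q ≤ 1) (F : Finset Edge)
    {A B A' B' A'' B'' : Set (ℤ × ℤ)}
    (h : ∀ η : F → Bool × Bool,
      BiConn (fun e : F => eSrc e) (fun e : F => eDst e) A B η →
      BiConn (fun e : F => eSrc e) (fun e : F => eDst e) A' B' η →
      BiConn (fun e : F => eSrc e) (fun e : F => eDst e) A'' B'' η) :
    mu q (Conn F A B) * mu q (Conn F A' B') ≤ mu q (Conn F A'' B'') := by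
  classical
  have := isProbabilityMeasure_mu h0 h1
  rw [← ENNReal.toReal_le_toReal (ENNReal.mul_ne_top (measure_ne_top _ _) (measure_ne_top _ _))
    (measure_ne_top _ _), ENNReal.toReal_mul, mu_conn_toReal h0 h1, mu_conn_toReal h0 h1,
    mu_conn_toReal h0 h1]
  have hw : ∀ η : F → Bool × Bool, 0 ≤ ∏ e, indepWeight q (η e) := fun η =>
    Finset.prod_nonneg fun e _ => mul_nonneg (bitWeight_nonneg h0 h1 _)
      (bitWeight_nonneg (by linarith) (by linarith) _)
  have hnn : ∀ A B : Set (ℤ × ℤ),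
      0 ≤ biInd (fun e : F => eSrc e) (fun e : F => eDst e) A B := fun A B η => by
    unfold biInd; split_ifs <;> simp
  have hmono : ∀ A B : Set (ℤ × ℤ),
      Monotone (biInd (fun e : F => eSrc e) (fun e : F => eDst e) A B) := fun A B η η' hη => by
    unfold biInd
    by_cases hc : BiConn (fun e : F => eSrc e) (fun e : F => eDst e) A B η
    · rw [if_pos hc, if_pos (hc.mono hη)]
    · rw [if_neg hc]
      split_ifs <;> simp
  refine (fkg _ _ _ (fun η => hw η) (hnn A B) (hnn A' B') (hmono A B) (hmono A' B') ?_).trans ?_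
  · intro a b
    simp only [Pi.inf_apply, Pi.sup_apply]
    rw [← Finset.prod_mul_distrib, ← Finset.prod_mul_distrib]
    exact le_of_eq (Finset.prod_congr rfl fun e _ => indepWeight_mul q _ _)
  · rw [sum_prod_indepWeight, one_mul]
    refine Finset.sum_le_sum fun η _ => mul_le_mul_of_nonneg_left ?_ (hw η)
    unfold biInd
    have := h η
    split_ifs <;> first | (exfalso; tauto) | norm_num

/-- Nearest-neighbour relation of the square lattice. -/
def LatAdj (u v : ℤ × ℤ) : Prop :=
  (v.1 = u.1 + 1 ∧ v.2 = u.2) ∨ (u.1 = v.1 + 1 ∧ v.2 = u.2) ∨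
    (v.1 = u.1 ∧ v.2 = u.2 + 1) ∨ (v.1 = u.1 ∧ u.2 = v.2 + 1)

lemma latAdj_edge (e : Edge) : LatAdj (eSrc e) (eDst e) := by
  rcases e with ⟨⟨x, y⟩, _ | _⟩ <;> simp [LatAdj, eSrc, eDst]

lemma LatAdj.symm {u v : ℤ × ℤ} (h : LatAdj u v) : LatAdj v u := by
  unfold LatAdj at *
  omega

/-- `c X Y` is the net number of steps of a walk from `a` to `b` from column `X` to column `X + 1`
at heights at least `Y`, and `d X Y` is the net number of steps from `(X, Y - 1)` to `(X, Y)`. -/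
structure IsFlow (r : ℤ × ℤ → ℤ × ℤ → Prop) (a b : ℤ × ℤ) (c d : ℤ → ℤ → ℤ) : Prop where
  balance : ∀ X Y : ℤ, (if b.1 = X ∧ Y ≤ b.2 then 1 else 0 : ℤ) -
    (if a.1 = X ∧ Y ≤ a.2 then 1 else 0) = c (X - 1) Y - c X Y + d X Y
  le_of_not_right : ∀ X Y, ¬r (X, Y) (X + 1, Y) → c X Y ≤ c X (Y + 1)
  ge_of_not_left : ∀ X Y, ¬r (X + 1, Y) (X, Y) → c X (Y + 1) ≤ c X Y
  nonpos_of_not_up : ∀ X Y, ¬r (X, Y - 1) (X, Y) → d X Y ≤ 0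
  nonneg_of_not_down : ∀ X Y, ¬r (X, Y) (X, Y - 1) → 0 ≤ d X Y
  eq_zero : ∀ X Y, (∀ Y' ≥ Y, ¬r (X, Y') (X + 1, Y') ∧ ¬r (X + 1, Y') (X, Y')) → c X Y = 0

lemma exists_isFlow {r : ℤ × ℤ → ℤ × ℤ → Prop} (hr : ∀ u v, r u v → LatAdj u v) {a b : ℤ × ℤ}
    (h : ReflTransGen r a b) : ∃ c d, IsFlow r a b c d := by
  induction h with
  | refl => exact ⟨fun _ _ => 0, fun _ _ => 0, by constructor <;> simp⟩
  | @tail u v _ huv ih =>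
    obtain ⟨c, d, h⟩ := ih
    obtain ⟨u1, u2⟩ := u
    obtain ⟨v1, v2⟩ := v
    rcases hr _ _ huv with hs | hs | hs | hs <;> obtain ⟨e1, e2⟩ := hs <;> dsimp only at e1 e2
    · subst e1 e2
      refine ⟨fun X Y => c X Y + if X = u1 ∧ Y ≤ v2 then 1 else 0, d,
        fun X Y => ?_, fun X Y hX => ?_, fun X Y hX => ?_, h.nonpos_of_not_up,
        h.nonneg_of_not_down, fun X Y hX => ?_⟩
      · have := h.balance X Y
        split_ifs at * <;> simp at * <;> omega
      · have := h.le_of_not_right X Y hX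
        have hne : ¬(X = u1 ∧ Y = v2) := by
          rintro ⟨rfl, rfl⟩; exact hX huv
        split_ifs <;> omega
      · have := h.ge_of_not_left X Y hX
        split_ifs <;> omega
      · have := h.eq_zero X Y hX
        have hne : ¬(X = u1 ∧ Y ≤ v2) := by
          rintro ⟨rfl, hY⟩; exact (hX _ hY).1 huv
        rw [this, if_neg hne, add_zero]
    · subst e1 e2
      refine ⟨fun X Y => c X Y - if X = v1 ∧ Y ≤ v2 then 1 else 0, d,
        fun X Y => ?_, fun X Y hX => ?_, fun X Y hX => ?_, h.nonpos_of_not_up,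
        h.nonneg_of_not_down, fun X Y hX => ?_⟩
      · have := h.balance X Y
        split_ifs at * <;> simp at * <;> omega
      · have := h.le_of_not_right X Y hX
        split_ifs <;> omega
      · have := h.ge_of_not_left X Y hX
        have hne : ¬(X = v1 ∧ Y = v2) := by
          rintro ⟨rfl, rfl⟩; exact hX huv
        split_ifs <;> omega
      · have := h.eq_zero X Y hX
        have hne : ¬(X = v1 ∧ Y ≤ v2) := by
          rintro ⟨rfl, hY⟩; exact (hX _ hY).2 huv
        rw [this, if_neg hne, sub_zero]
    · subst e1 e2
      refine ⟨c, fun X Y => d X Y + if X = v1 ∧ Y = u2 + 1 then 1 else 0,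
        fun X Y => ?_, h.le_of_not_right, h.ge_of_not_left, fun X Y hX => ?_, fun X Y hX => ?_,
        h.eq_zero⟩
      · have := h.balance X Y
        split_ifs at * <;> simp at * <;> omega
      · have := h.nonpos_of_not_up X Y hX
        have hne : ¬(X = v1 ∧ Y = u2 + 1) := by
          rintro ⟨rfl, rfl⟩; exact hX (by simpa using huv)
        rwa [if_neg hne, add_zero]
      · have := h.nonneg_of_not_down X Y hX
        split_ifs <;> omega
    · subst e1 e2
      refine ⟨c, fun X Y => d X Y - if X = v1 ∧ Y = v2 + 1 then 1 else 0,
        fun X Y => ?_, h.le_of_not_right, h.ge_of_not_left, fun X Y hX => ?_, fun X Y hX => ?_,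
        h.eq_zero⟩
      · have := h.balance X Y
        split_ifs at * <;> simp at * <;> omega
      · have := h.nonpos_of_not_up X Y hX
        split_ifs <;> omega
      · have := h.nonneg_of_not_down X Y hX
        have hne : ¬(X = v1 ∧ Y = v2 + 1) := by
          rintro ⟨rfl, rfl⟩; exact hX (by simpa using huv)
        rwa [if_neg hne, sub_zero]

lemma IsFlow.eq_one {r : ℤ × ℤ → ℤ × ℤ → Prop} {b : ℤ × ℤ} {c d : ℤ → ℤ → ℤ}
    (h : IsFlow r (0, 0) b c d)
    (hr : ∀ u v, r u v → 0 ≤ u.1 ∧ 0 ≤ u.2 ∧ 0 ≤ v.1 ∧ 0 ≤ v.2) (k : ℕ) (hk : (k : ℤ) < b.1) :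
    c k 0 = 1 := by
  have hd : ∀ X, d X 0 = 0 := fun X => le_antisymm
    (h.nonpos_of_not_up X 0 fun hc => by have := hr _ _ hc; simp at this)
    (h.nonneg_of_not_down X 0 fun hc => by have := hr _ _ hc; simp at this)
  induction k with
  | zero =>
    have h1 : c (-1) 0 = 0 := h.eq_zero _ _ fun Y' _ =>
      ⟨fun hc => by have := hr _ _ hc; simp at this, fun hc => by have := hr _ _ hc; simp at this⟩
    have h2 := h.balance 0 0
    rw [if_neg (by rintro ⟨h, -⟩; simp at hk; omega), if_pos (by simp), hd] at h2
    simp at h2 ⊢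
    omega
  | succ k ih =>
    have h2 := h.balance (k + 1 : ℕ) 0
    rw [if_neg (by rintro ⟨h, -⟩; omega), if_neg (by push_cast; simp; omega), hd] at h2
    have h3 := ih (by push_cast at hk; omega)
    push_cast at h2 ⊢
    rw [add_sub_cancel_right] at h2
    omega

/-- A walk from the corner `(0,0)` of a square to its right side meets every walk from the bottom
side to the corner `(n,n)`. -/
lemma reflTransGen_of_crossing {r : ℤ × ℤ → ℤ × ℤ → Prop} {n : ℤ} (hn : 1 ≤ n)
    (hr : ∀ u v, r u v → LatAdj u v)
    (hsq : ∀ u v, r u v → (0 ≤ u.1 ∧ u.1 ≤ n ∧ 0 ≤ u.2 ∧ u.2 ≤ n) ∧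
      (0 ≤ v.1 ∧ v.1 ≤ n ∧ 0 ≤ v.2 ∧ v.2 ≤ n))
    {b a' : ℤ × ℤ} (hb : b.1 = n) (hP : ReflTransGen r (0, 0) b)
    (ha' : a'.2 = 0) (ha0 : 0 ≤ a'.1) (han : a'.1 ≤ n) (hπ : ReflTransGen r a' (n, n)) :
    ReflTransGen r (0, 0) (n, n) := by
  by_contra hcon
  let S : Set (ℤ × ℤ) := {z | ReflTransGen r (0, 0) z}
  let rP : ℤ × ℤ → ℤ × ℤ → Prop := fun u v => r u v ∧ u ∈ S ∧ v ∈ S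
  have hP' : ReflTransGen rP (0, 0) b := by
    clear hb
    induction hP with
    | refl => exact .refl
    | tail h1 h2 ih => exact ih.tail ⟨h2, h1, h1.tail h2⟩
  obtain ⟨c, d, hF⟩ := exists_isFlow (fun u v h => hr u v h.1) hP'
  have hone := hF.eq_one fun u v h => by
    have := hsq u v h.1
    omega
  rw [hb] at hone
  -- off the walk, the flow does not change
  have hc1 : ∀ X Y, (X, Y) ∉ S → c X Y = c X (Y + 1) := fun X Y h =>
    le_antisymm (hF.le_of_not_right _ _ fun hc => h hc.2.1)
      (hF.ge_of_not_left _ _ fun hc => h hc.2.2)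
  have hc2 : ∀ X Y, (X + 1, Y) ∉ S → c X Y = c X (Y + 1) := fun X Y h =>
    le_antisymm (hF.le_of_not_right _ _ fun hc => h hc.2.2)
      (hF.ge_of_not_left _ _ fun hc => h hc.2.1)
  have hd : ∀ X Y, (X, Y) ∉ S → d X Y = 0 := fun X Y h =>
    le_antisymm (hF.nonpos_of_not_up _ _ fun hc => h hc.2.2)
      (hF.nonneg_of_not_down _ _ fun hc => h hc.2.1)
  have hvert : ∀ X Y, 0 ≤ X → X ≤ n → (X, Y) ∉ S →
      c (min X (n - 1)) Y = c (min X (n - 1)) (Y + 1) := by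
    intro X Y h0 h1 h
    rcases h1.eq_or_lt with rfl | h1
    · rw [min_eq_right (by omega)]
      exact hc2 _ _ (by simpa using h)
    · rw [min_eq_left (by omega)]
      exact hc1 _ _ h
  have hhor : ∀ X Y, 0 ≤ X → X + 1 ≤ n → (X + 1, Y) ∉ S →
      c (min X (n - 1)) Y = c (min (X + 1) (n - 1)) Y := by
    intro X Y h0 h1 h
    rcases h1.eq_or_lt with h1 | h1
    · rw [min_eq_left (by omega), min_eq_right (by omega), ← h1, add_sub_cancel_right]
    · rw [min_eq_left (by omega), min_eq_left (by omega)]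
      have := hF.balance (X + 1) Y
      rw [if_neg (by rintro ⟨h, -⟩; omega), if_neg (by rintro ⟨h, -⟩; simp at h; omega),
        hd _ _ h, add_sub_cancel_right] at this
      omega
  have hconst : ∀ z, ReflTransGen r z (n, n) → 0 ≤ z.1 → z.1 ≤ n →
      c (min z.1 (n - 1)) z.2 = c (n - 1) n := by
    intro z hz
    induction hz using ReflTransGen.head_induction_on with
    | refl => intro _ _; rw [min_eq_right (by simp)]
    | @head u v huv hv ih =>
      intro _ _
      have hsq' := hsq u v huv
      rw [← ih (by omega) (by omega)]
      have hu : u ∉ S := fun h => hcon (ReflTransGen.trans h (ReflTransGen.head huv hv))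
      have hvS : v ∉ S := fun h => hcon (ReflTransGen.trans h hv)
      obtain ⟨u1, u2⟩ := u
      obtain ⟨v1, v2⟩ := v
      dsimp only at *
      rcases hr _ _ huv with hs | hs | hs | hs <;> obtain ⟨e1, e2⟩ := hs <;> dsimp only at e1 e2
      · subst e1 e2
        exact hhor _ _ (by omega) (by omega) hvS
      · subst e1 e2
        exact (hhor _ _ (by omega) (by omega) hu).symm
      · subst e1 e2
        exact hvert _ _ (by omega) (by omega) hu
      · subst e1 e2
        exact (hvert _ _ (by omega) (by omega) hvS).symm
  have htop : c (n - 1) n = 0 := by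
    rw [hc2 _ _ (by rw [sub_add_cancel]; exact hcon)]
    refine hF.eq_zero _ _ fun Y' hY' => ⟨fun hc => ?_, fun hc => ?_⟩ <;>
    · have := hsq _ _ hc.1
      simp only at this
      omega
  have h1 := hconst a' hπ ha0 han
  have hk := hone (min a'.1 (n - 1)).toNat (by omega)
  rw [Int.toNat_of_nonneg (by omega)] at hk
  rw [ha', hk, htop] at h1
  omega

lemma DetBy.measurableSet_of_finite {F : Set Edge} (hF : F.Finite) {E : Set Config}
    (h : DetBy F E) : MeasurableSet E :=
  DetBy.measurableSet (F := hF.toFinset) (by rwa [hF.coe_toFinset])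

lemma mu_inter_of_finite {p : ℝ} (h0 : 0 ≤ p) (h1 : p ≤ 1) {F F' : Set Edge} (hF : F.Finite)
    (hF' : F'.Finite) (hd : Disjoint F F') {E E' : Set Config} (hE : DetBy F E)
    (hE' : DetBy F' E') : mu p (E ∩ E') = mu p E * mu p E' :=
  mu_inter h0 h1 (F := hF.toFinset) (F' := hF'.toFinset)
    (by rwa [← Finset.disjoint_coe, hF.coe_toFinset, hF'.coe_toFinset])
    (by rwa [hF.coe_toFinset]) (by rwa [hF'.coe_toFinset])

lemma detBy_apply (e : Edge) (b : Bool) : DetBy {e} {ω | ω e = b} := by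
  intro ω ω' h hω
  exact (h e rfl).symm.trans hω

/-- The edges with both endpoints in `D`. -/
def within (D : Set (ℤ × ℤ)) : Set Edge := {e | eSrc e ∈ D ∧ eDst e ∈ D}

lemma within_mono {D D' : Set (ℤ × ℤ)} (h : D ⊆ D') : within D ⊆ within D' :=
  fun _ he => ⟨h he.1, h he.2⟩

lemma finite_within {D : Set (ℤ × ℤ)} (h : D.Finite) : (within D).Finite :=
  (h.prod Set.finite_univ).subset fun _ he => ⟨he.1, Set.mem_univ _⟩

lemma stp.latAdj {F : Set Edge} {ω : Config} {u v : ℤ × ℤ} (h : stp F ω u v) : LatAdj u v := by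
  obtain ⟨e, _, ⟨rfl, rfl, _⟩ | ⟨rfl, rfl, _⟩⟩ := h
  · exact latAdj_edge e
  · exact (latAdj_edge e).symm

lemma stp.mem {D : Set (ℤ × ℤ)} {ω : Config} {u v : ℤ × ℤ} (h : stp (within D) ω u v) :
    u ∈ D ∧ v ∈ D := by
  obtain ⟨e, he, ⟨rfl, rfl, _⟩ | ⟨rfl, rfl, _⟩⟩ := h
  · exact he
  · exact he.symm

lemma stp.mono {F F' : Set Edge} (hF : F ⊆ F') {ω : Config} {u v : ℤ × ℤ} (h : stp F ω u v) :
    stp F' ω u v := by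
  obtain ⟨e, he, h⟩ := h
  exact ⟨e, hF he, h⟩

lemma reflTransGen_stp_mono {F F' : Set Edge} (hF : F ⊆ F') {ω : Config} {u v : ℤ × ℤ}
    (h : ReflTransGen (stp F ω) u v) : ReflTransGen (stp F' ω) u v :=
  ReflTransGen.mono (fun _ _ => stp.mono hF) _ _ h

lemma mu_conn_mul_le_of_finite {q : ℝ} (h0 : 0 ≤ q) (h1 : q ≤ 1) {F : Set Edge} (hF : F.Finite)
    {A B A' B' A'' B'' : Set (ℤ × ℤ)}
    (h : ∀ r : ℤ × ℤ → ℤ × ℤ → Prop, (∀ u v, r u v → ∃ e ∈ F,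
        (eSrc e = u ∧ eDst e = v) ∨ (eSrc e = v ∧ eDst e = u)) →
      (∃ a ∈ A, ∃ b ∈ B, ReflTransGen r a b) → (∃ a ∈ A', ∃ b ∈ B', ReflTransGen r a b) →
      ∃ a ∈ A'', ∃ b ∈ B'', ReflTransGen r a b) :
    mu q (Conn F A B) * mu q (Conn F A' B') ≤ mu q (Conn F A'' B'') := by
  have := mu_conn_mul_le h0 h1 hF.toFinset (A := A) (B := B) (A' := A') (B' := B') (A'' := A'')
    (B'' := B'') fun η => h _ fun u v huv => by
      obtain ⟨e, he⟩ := huv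
      exact ⟨e, hF.mem_toFinset.1 e.2, he.imp (fun h => ⟨h.1, h.2.1⟩) (fun h => ⟨h.1, h.2.1⟩)⟩
  rwa [hF.coe_toFinset] at this

section Maps

variable {F F' : Set Edge} {A A' B B' : Set (ℤ × ℤ)} {φ : Edge → Edge} {f : ℤ × ℤ → ℤ × ℤ}

lemma conn_of_map (hs : ∀ e, eSrc (φ e) = f (eSrc e)) (hd : ∀ e, eDst (φ e) = f (eDst e))
    (hF : ∀ e ∈ F, φ e ∈ F') (hA : ∀ a ∈ A, f a ∈ A') (hB : ∀ b ∈ B, f b ∈ B') {ω : Config}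
    (h : (fun e => ω (φ e)) ∈ Conn F A B) : ω ∈ Conn F' A' B' := by
  obtain ⟨a, ha, b, hb, hab⟩ := h
  refine ⟨f a, hA a ha, f b, hB b hb, hab.lift f ?_⟩
  rintro _ _ ⟨e, he, ⟨rfl, rfl, h⟩ | ⟨rfl, rfl, h⟩⟩
  · exact ⟨φ e, hF e he, Or.inl ⟨hs e, hd e, h⟩⟩
  · exact ⟨φ e, hF e he, Or.inr ⟨hs e, hd e, h⟩⟩

lemma conn_of_map_reverse (hs : ∀ e, eSrc (φ e) = f (eDst e))
    (hd : ∀ e, eDst (φ e) = f (eSrc e))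
    (hF : ∀ e ∈ F, φ e ∈ F') (hA : ∀ a ∈ A, f a ∈ A') (hB : ∀ b ∈ B, f b ∈ B') {ω : Config}
    (h : (fun e => ω (φ e)) ∈ Conn F A B) : ω ∈ Conn F' B' A' := by
  obtain ⟨a, ha, b, hb, hab⟩ := h
  refine ⟨f b, hB b hb, f a, hA a ha, ?_⟩
  rw [← reflTransGen_swap]
  refine hab.lift f ?_
  rintro _ _ ⟨e, he, ⟨rfl, rfl, h⟩ | ⟨rfl, rfl, h⟩⟩
  · exact ⟨φ e, hF e he, Or.inl ⟨hs e, hd e, h⟩⟩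
  · exact ⟨φ e, hF e he, Or.inr ⟨hs e, hd e, h⟩⟩

variable {q : ℝ}

lemma mu_conn_le_of_imp (h0 : 0 ≤ q) (h1 : q ≤ 1) (hfin : F.Finite) (hφ : Function.Injective φ)
    (h : ∀ ω : Config, (fun e => ω (φ e)) ∈ Conn F A B → ω ∈ Conn F' A' B') :
    mu q (Conn F A B) ≤ mu q (Conn F' A' B') := by
  rw [← mu_reindex h0 h1 hφ ((detBy_conn F A B).measurableSet_of_finite hfin)]
  exact measure_mono h

end Maps

/-- The rectangle `[0, l] × [0, H]`. -/
def rect (l H : ℤ) : Set (ℤ × ℤ) := {v | 0 ≤ v.1 ∧ v.1 ≤ l ∧ 0 ≤ v.2 ∧ v.2 ≤ H}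

/-- The block of side `N` in the lower right corner of `[0, n]²`. -/
def block (N n : ℤ) : Set (ℤ × ℤ) := {v | n - N < v.1 ∧ v.1 ≤ n ∧ 0 ≤ v.2 ∧ v.2 < N}

/-- The square `[0, n]²` with the lower right block removed. -/
def dom (N n : ℤ) : Set (ℤ × ℤ) := rect n n \ block N n

/-- The edges of `[0, n]²` that are not inside the lower right block. -/
def hitEdges (N n : ℤ) : Set Edge := within (rect n n) \ within (block N n)

lemma finite_rect (l H : ℤ) : (rect l H).Finite :=
  ((Set.finite_Icc 0 l).prod (Set.finite_Icc 0 H)).subset fun _ hv =>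
    ⟨⟨hv.1, hv.2.1⟩, ⟨hv.2.2.1, hv.2.2.2⟩⟩

lemma finite_dom (N n : ℤ) : (dom N n).Finite := (finite_rect n n).subset Set.sdiff_subset

lemma finite_hitEdges (N n : ℤ) : (hitEdges N n).Finite :=
  (finite_within (finite_rect n n)).subset Set.sdiff_subset

/-- The right side of `[0, n]²`. -/
def rightSide (n : ℤ) : Set (ℤ × ℤ) := {v | v.1 = n ∧ 0 ≤ v.2 ∧ v.2 ≤ n}

/-- The bottom side of `[0, n]²`. -/
def bottomSide (n : ℤ) : Set (ℤ × ℤ) := {v | v.2 = 0 ∧ 0 ≤ v.1 ∧ v.1 ≤ n}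

/-- The top side of `[0, n]²`. -/
def topSide (n : ℤ) : Set (ℤ × ℤ) := {v | v.2 = n ∧ 0 ≤ v.1 ∧ v.1 ≤ n}

/-- Reflection of edges in the antidiagonal of `[0, n]²`. -/
def antidiagEdge (n : ℤ) (e : Edge) : Edge :=
  if e.2 then ((n - e.1.2 - 1, n - e.1.1), false) else ((n - e.1.2, n - e.1.1 - 1), true)

lemma antidiagEdge_injective (n : ℤ) : Function.Injective (antidiagEdge n) := by
  rintro ⟨⟨x, y⟩, _ | _⟩ ⟨⟨x', y'⟩, _ | _⟩ h <;> simp [antidiagEdge] at h ⊢ <;> omega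

/-- Reflection of edges in the diagonal. -/
def diagEdge (e : Edge) : Edge := ((e.1.2, e.1.1), !e.2)

lemma diagEdge_injective : Function.Injective diagEdge := by
  rintro ⟨⟨x, y⟩, _ | _⟩ ⟨⟨x', y'⟩, _ | _⟩ h <;> simp [diagEdge] at h ⊢ <;> omega

variable {q : ℝ}

lemma mu_out_le_mu_in (h0 : 0 ≤ q) (h1 : q ≤ 1) (N n : ℤ) :
    mu q (Conn (within (dom N n)) {(0, 0)} (rightSide n)) ≤
      mu q (Conn (within (dom N n)) (bottomSide n) {(n, n)}) := by
  have hs : ∀ e, eSrc (antidiagEdge n e) = (n - (eDst e).2, n - (eDst e).1) := by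
    rintro ⟨⟨x, y⟩, _ | _⟩ <;> simp [eSrc, eDst, antidiagEdge] <;> ring
  have hd : ∀ e, eDst (antidiagEdge n e) = (n - (eSrc e).2, n - (eSrc e).1) := by
    rintro ⟨⟨x, y⟩, _ | _⟩ <;> simp [eSrc, eDst, antidiagEdge]
  have hdom : ∀ v ∈ dom N n, (n - v.2, n - v.1) ∈ dom N n := by
    rintro ⟨x, y⟩ ⟨hv, hv'⟩
    simp only [dom, rect, block, Set.mem_sdiff, Set.mem_ofPred_eq] at *
    omega
  refine mu_conn_le_of_imp h0 h1 (finite_within (finite_dom N n)) (antidiagEdge_injective n)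
    fun ω => conn_of_map_reverse (f := fun v => (n - v.2, n - v.1)) hs hd ?_ ?_ ?_
  · intro e he
    refine ⟨?_, ?_⟩
    · rw [hs]; exact hdom _ he.2
    · rw [hd]; exact hdom _ he.1
  · rintro _ rfl
    simp
  · rintro ⟨x, y⟩ ⟨h, h', h''⟩
    simp only [bottomSide, Set.mem_ofPred_eq] at *
    omega

lemma sq_mu_out_le (h0 : 0 ≤ q) (h1 : q ≤ 1) {N n : ℤ} (hn : 1 ≤ n) :
    mu q (Conn (within (dom N n)) {(0, 0)} (rightSide n)) ^ 2 ≤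
      mu q (Conn (within (dom N n)) {(0, 0)} {(n, n)}) := by
  rw [sq]
  refine (mul_le_mul_right (mu_out_le_mu_in h0 h1 N n) _).trans
    (mu_conn_mul_le_of_finite h0 h1 (finite_within (finite_dom N n)) ?_)
  rintro r hr ⟨_, rfl, b, hb, hab⟩ ⟨a', ha', _, rfl, hab'⟩
  refine ⟨_, rfl, _, rfl, reflTransGen_of_crossing hn ?_ ?_ hb.1 hab ha'.1 ha'.2.1 ha'.2.2 hab'⟩
  · intro u v huv
    obtain ⟨e, -, ⟨rfl, rfl⟩ | ⟨rfl, rfl⟩⟩ := hr u v huv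
    · exact latAdj_edge e
    · exact (latAdj_edge e).symm
  · intro u v huv
    obtain ⟨e, he, ⟨rfl, rfl⟩ | ⟨rfl, rfl⟩⟩ := hr u v huv
    · exact ⟨he.1.1, he.2.1⟩
    · exact ⟨he.2.1, he.1.1⟩

lemma mu_top_le_mu_right (h0 : 0 ≤ q) (h1 : q ≤ 1) (n : ℤ) :
    mu q (Conn (within (rect n n)) {(0, 0)} (topSide n)) ≤
      mu q (Conn (within (rect n n)) {(0, 0)} (rightSide n)) := by
  have hs : ∀ e, eSrc (diagEdge e) = ((eSrc e).2, (eSrc e).1) := by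
    rintro ⟨⟨x, y⟩, _ | _⟩ <;> simp [eSrc, diagEdge]
  have hd : ∀ e, eDst (diagEdge e) = ((eDst e).2, (eDst e).1) := by
    rintro ⟨⟨x, y⟩, _ | _⟩ <;> simp [eDst, diagEdge]
  have hdom : ∀ v ∈ rect n n, (v.2, v.1) ∈ rect n n := by
    rintro ⟨x, y⟩ hv
    simp only [rect, Set.mem_ofPred_eq] at *
    omega
  refine mu_conn_le_of_imp h0 h1 (finite_within (finite_rect n n)) diagEdge_injective
    fun ω => conn_of_map (f := fun v => (v.2, v.1)) hs hd ?_ ?_ ?_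
  · intro e he
    refine ⟨?_, ?_⟩
    · rw [hs]; exact hdom _ he.1
    · rw [hd]; exact hdom _ he.2
  · rintro _ rfl
    simp
  · rintro ⟨x, y⟩ ⟨h, h', h''⟩
    exact ⟨h, h', h''⟩

lemma conn_right_subset {N n : ℤ} (hN : N ≤ n) (hn : 0 ≤ n) :
    Conn (within (rect n n)) {(0, 0)} (rightSide n) ⊆
      Conn (within (dom N n)) {(0, 0)} (rightSide n) ∪
        Conn (hitEdges N n) {(0, 0)} (block N n) := by
  rintro ω ⟨_, rfl, b, hb, hab⟩
  suffices H : (b ∈ dom N n ∧ ReflTransGen (stp (within (dom N n)) ω) (0, 0) b) ∨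
      ω ∈ Conn (hitEdges N n) {(0, 0)} (block N n) by
    exact H.imp (fun h => ⟨_, rfl, b, hb, h.2⟩) id
  clear hb
  induction hab with
  | refl =>
    refine Or.inl ⟨⟨?_, ?_⟩, .refl⟩
    · simp [rect, hn]
    · simp only [block, Set.mem_ofPred_eq]
      omega
  | @tail u v _ huv ih =>
    rcases ih with ⟨hu, ih⟩ | ih
    · have hv := huv.mem.2
      have hin : within (dom N n) ⊆ hitEdges N n := fun e he =>
        ⟨within_mono Set.sdiff_subset he, fun h => he.1.2 h.1⟩
      by_cases hvb : v ∈ block N n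
      · refine Or.inr ⟨_, rfl, v, hvb, (reflTransGen_stp_mono hin ih).tail ?_⟩
        obtain ⟨e, he, h⟩ := huv
        refine ⟨e, ⟨he, fun he' => ?_⟩, h⟩
        rcases h with ⟨rfl, rfl, _⟩ | ⟨rfl, rfl, _⟩
        · exact hu.2 he'.1
        · exact hu.2 he'.2
      · refine Or.inl ⟨⟨hv, hvb⟩, ih.tail ?_⟩
        obtain ⟨e, he, h⟩ := huv
        refine ⟨e, ?_, h⟩
        rcases h with ⟨rfl, rfl, _⟩ | ⟨rfl, rfl, _⟩
        · exact ⟨hu, ⟨hv, hvb⟩⟩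
        · exact ⟨⟨hv, hvb⟩, hu⟩
    · exact Or.inr ih

lemma percolates_subset {n : ℤ} (hn : 0 ≤ n) :
    {ω | percolates (gStep ω) NEquad} ⊆ Conn (within (rect n n)) {(0, 0)} (rightSide n) ∪
      Conn (within (rect n n)) {(0, 0)} (topSide n) := by
  classical
  rintro ω ⟨γ, h0, hinj, hstep, hq⟩
  have hex : ∃ i, γ i ∉ rect n n := by
    by_contra! hc
    exact Set.infinite_of_injective_forall_mem hinj hc (finite_rect n n)
  have hmin : ∀ i < Nat.find hex, γ i ∈ rect n n := fun i hi => by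
    simpa using Nat.find_min hex hi
  have hT := Nat.find_spec hex
  obtain ⟨k, hk⟩ : ∃ k, Nat.find hex = k + 1 := by
    refine Nat.exists_eq_succ_of_ne_zero fun h => ?_
    rw [h, h0] at hT
    exact hT (by simp [rect, hn])
  rw [hk] at hmin hT
  have hlat : ∀ {u v}, gStep ω u v → LatAdj u v := by
    rintro u v ⟨e, ⟨rfl, rfl, _⟩ | ⟨rfl, rfl, _⟩⟩
    · exact latAdj_edge e
    · exact (latAdj_edge e).symm
  have hpath : ∀ i ≤ k, ReflTransGen (stp (within (rect n n)) ω) (0, 0) (γ i) := by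
    intro i
    induction i with
    | zero => intro _; rw [h0]
    | succ i ih =>
      intro hi
      refine (ih (by omega)).tail ?_
      have hi1 := hmin i (by omega)
      have hi2 := hmin (i + 1) (by omega)
      obtain ⟨e, he⟩ := hstep i
      refine ⟨e, ?_, he⟩
      rcases he with ⟨h, h', _⟩ | ⟨h, h', _⟩
      · exact ⟨h ▸ hi1, h' ▸ hi2⟩
      · exact ⟨h ▸ hi2, h' ▸ hi1⟩
  have hadj := hlat (hstep k)
  have hk1 := hmin k (by omega)
  have hk2 := hq (k + 1)
  have hside : γ k ∈ rightSide n ∨ γ k ∈ topSide n := by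
    simp only [rect, NEquad, LatAdj, rightSide, topSide, Set.mem_ofPred_eq] at *
    omega
  exact hside.imp (fun h => ⟨_, rfl, _, h, hpath k le_rfl⟩)
    (fun h => ⟨_, rfl, _, h, hpath k le_rfl⟩)

lemma thetaNE_le (h0 : 0 ≤ q) (h1 : q ≤ 1) {N n : ℤ} (hN : N ≤ n) (hn : 0 ≤ n) :
    thetaNE q ≤ 2 * (mu q (Conn (within (dom N n)) {(0, 0)} (rightSide n)) +
      mu q (Conn (hitEdges N n) {(0, 0)} (block N n))) := by
  refine (measure_mono (percolates_subset hn)).trans ((measure_union_le _ _).trans ?_)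
  have h := (measure_mono (μ := mu q) (conn_right_subset hN hn)).trans (measure_union_le _ _)
  rw [two_mul]
  exact add_le_add h ((mu_top_le_mu_right h0 h1 n).trans h)

lemma DetBy.reindex {F : Set Edge} {E : Set Config} (h : DetBy F E) (φ : Edge → Edge)
    (g : Bool → Bool) : DetBy (φ '' F) {ω | (fun e => g (ω (φ e))) ∈ E} :=
  fun _ _ hω hE => h _ _ (fun _ he => congrArg g (hω _ (Set.mem_image_of_mem _ he))) hE

/-- The primal edge crossed by the image of `e` under `(x, y) ↦ (n - x + 1/2, y + 1/2)`. -/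
def crossEdge (n : ℤ) (e : Edge) : Edge :=
  if e.2 then ((n - e.1.1, e.1.2 + 1), false) else ((n - e.1.1, e.1.2), true)

lemma crossEdge_injective (n : ℤ) : Function.Injective (crossEdge n) := by
  rintro ⟨⟨x, y⟩, _ | _⟩ ⟨⟨x', y'⟩, _ | _⟩ h <;> simp [crossEdge] at h ⊢ <;> omega

lemma stp_within_rect {l H : ℤ} {ω : Config} {x y x' y' : ℤ}
    (h : stp (within (rect l H)) ω (x, y) (x', y')) :
    (x' = x + 1 ∧ y' = y ∧ ω ((x, y), false) = true) ∨
    (x' = x ∧ y' = y + 1 ∧ ω ((x, y), true) = true) ∨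
    (x = x' + 1 ∧ y' = y ∧ ω ((x', y'), false) = false) ∨
    (x' = x ∧ y = y' + 1 ∧ ω ((x', y'), true) = false) := by
  obtain ⟨⟨⟨u, v⟩, _ | _⟩, -, ⟨h1, h2, h3⟩ | ⟨h1, h2, h3⟩⟩ := h <;>
    simp only [eSrc, eDst, Prod.mk.injEq, if_true, if_false, Bool.false_eq_true] at h1 h2 <;>
    obtain ⟨rfl, rfl⟩ := h1 <;> obtain ⟨rfl, rfl⟩ := h2 <;> simp [h3]

/-- A walk from `(0, 0)` to `(m', 0)` in the upper half plane cannot avoid a dual walk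
from the right of `(m', 0)` that is continued to the bottom between `(m, 0)` and
`(m + 1, 0)`. -/
lemma not_conn_of_dual_conn {n m m' H : ℤ} (hm : 0 ≤ m) (hmm : m < m') (hmn : m' ≤ n) {ω : Config}
    (h : ω ∈ Conn (within (rect m' H)) {(0, 0)} {(m', 0)})
    (hf : ω ((m, 0), false) = false) :
    (fun e => ω (crossEdge n e)) ∉ Conn (within (rect (n - m) H)) {(0, 0)} {(n - m, 0)} := by
  rintro ⟨_, rfl, _, rfl, hγ⟩
  obtain ⟨_, rfl, _, rfl, hw⟩ := h
  obtain ⟨c, d, hc⟩ := exists_isFlow (fun _ _ => stp.latAdj) hγ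
  have hone : c (n - m') 0 = 1 := by
    have := hc.eq_one (fun u v huv => by
      have := huv.mem
      simp only [rect, Set.mem_ofPred_eq] at this
      omega) (n - m').toNat (by dsimp only; omega)
    rwa [Int.toNat_of_nonneg (by omega)] at this
  have hzero : c (n - 0) 0 = 0 := by
    refine hc.eq_zero _ _ fun Y _ => ⟨fun h => ?_, fun h => ?_⟩ <;>
    · have := h.mem
      simp only [rect, Set.mem_ofPred_eq] at this
      omega
  have hmono : ∀ v : ℤ × ℤ, ReflTransGen (stp (within (rect m' H)) ω) (0, 0) v →
      c (n - v.1) v.2 ≤ c (n - 0) 0 := by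
    intro v hv
    induction hv with
    | refl => exact le_rfl
    | @tail u v _ huv ih =>
      refine le_trans ?_ ih
      obtain ⟨x, y⟩ := u
      obtain ⟨x', y'⟩ := v
      have hmem := huv.mem
      simp only [rect, Set.mem_ofPred_eq] at hmem
      rcases stp_within_rect huv with ⟨rfl, rfl, hb⟩ | ⟨rfl, rfl, hb⟩ | ⟨rfl, rfl, hb⟩ |
        ⟨rfl, rfl, hb⟩ <;> dsimp only
      · have hd := hc.nonneg_of_not_down (n - x) y' fun h => by
          have := stp_within_rect h
          simp [crossEdge, hb] at this
          omega
        have hbal := hc.balance (n - x) y'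
        have : ¬ (n - m = n - x ∧ y' ≤ 0) := by
          rintro ⟨h1, h2⟩
          obtain rfl : x = m := by omega
          obtain rfl : y' = 0 := by omega
          simp [hf] at hb
        rw [if_neg this] at hbal
        have e : n - (x + 1) = n - x - 1 := by ring
        rw [e]
        split_ifs at hbal <;> linarith
      · refine hc.ge_of_not_left _ _ fun h => ?_
        have := stp_within_rect h
        simp [crossEdge, hb] at this
        omega
      · have hd := hc.nonpos_of_not_up (n - x') y' fun h => by
          have := stp_within_rect h
          simp [crossEdge, hb] at this
          omega
        have hbal := hc.balance (n - x') y'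
        have : ¬ ((0 : ℤ) = n - x' ∧ y' ≤ 0) := by omega
        rw [if_neg this] at hbal
        have e : n - (x' + 1) = n - x' - 1 := by ring
        rw [e]
        split_ifs at hbal <;> linarith
      · refine hc.le_of_not_right _ _ fun h => ?_
        have := stp_within_rect h
        simp [crossEdge, hb] at this
        omega
  have := hmono _ hw
  dsimp only at this
  omega

/-- The event that a walk from `(0, 0)` to `(m, 0)` in `[0, m] × [0, H]` is followed by a dual
walk from `(n, 0)` that is continued to the bottom just to the right of `(m, 0)`. -/
def turnEvent (n H m : ℤ) : Set Config :=
  Conn (within (rect m H)) {(0, 0)} {(m, 0)} ∩ ({ω | ω ((m, 0), false) = false} ∩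
    {ω | (fun e => ω (crossEdge n e)) ∈ Conn (within (rect (n - m) H)) {(0, 0)} {(n - m, 0)}})

lemma detBy_cross (n H m : ℤ) : DetBy (crossEdge n '' within (rect (n - m) H))
    {ω | (fun e => ω (crossEdge n e)) ∈ Conn (within (rect (n - m) H)) {(0, 0)} {(n - m, 0)}} :=
  (detBy_conn _ _ _).reindex (crossEdge n) id

lemma detBy_turnEvent (n H m : ℤ) :
    DetBy (within (rect m H) ∪ ({((m, 0), false)} ∪ crossEdge n '' within (rect (n - m) H)))
      (turnEvent n H m) :=
  (detBy_conn _ _ _).inter ((detBy_apply _ _).inter (detBy_cross n H m))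

lemma finite_cross (n H m : ℤ) :
    ({((m, 0), false)} ∪ crossEdge n '' within (rect (n - m) H) : Set Edge).Finite :=
  (Set.finite_singleton _).union ((finite_within (finite_rect _ _)).image _)

lemma mu_turnEvent (h0 : 0 ≤ q) (h1 : q ≤ 1) (n H m : ℤ) :
    mu q (turnEvent n H m) = mu q (Conn (within (rect m H)) {(0, 0)} {(m, 0)}) *
      (ENNReal.ofReal (1 - q) *
        mu q (Conn (within (rect (n - m) H)) {(0, 0)} {(n - m, 0)})) := by
  have hfin := finite_within (finite_rect (n - m) H)
  rw [turnEvent, mu_inter_of_finite h0 h1 (finite_within (finite_rect _ _)) (finite_cross n H m)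
    ?_ (detBy_conn _ _ _) ((detBy_apply _ _).inter (detBy_cross n H m)),
    mu_inter_of_finite h0 h1 (Set.finite_singleton _) (hfin.image _) ?_ (detBy_apply _ _)
      (detBy_cross n H m),
    mu_reindex h0 h1 (crossEdge_injective n)
      ((detBy_conn _ _ _).measurableSet_of_finite hfin), mu_apply_false h0 h1]
  · rw [Set.disjoint_left]
    rintro _ rfl ⟨⟨⟨x, y⟩, _ | _⟩, he, h⟩
    · simp [crossEdge] at h
    · simp only [crossEdge, if_true, Prod.mk.injEq, within, rect, eSrc, eDst,
        Set.mem_ofPred_eq] at h he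
      omega
  · rw [Set.disjoint_left]
    rintro ⟨⟨x, y⟩, _ | _⟩ he (h | ⟨⟨⟨x', y'⟩, _ | _⟩, he', h⟩) <;>
      simp [crossEdge, within, rect, eSrc, eDst] at h he <;>
      try simp [within, rect, eSrc, eDst] at he'
    all_goals omega

lemma sum_mu_conn_mul_le_one (h0 : 0 ≤ q) (h1 : q ≤ 1) (n : ℕ) (H : ℤ) :
    ∑ m ∈ Finset.range (n + 1), mu q (Conn (within (rect m H)) {(0, 0)} {((m : ℤ), 0)}) *
      (ENNReal.ofReal (1 - q) *
        mu q (Conn (within (rect (n - m) H)) {(0, 0)} {((n - m : ℤ), 0)})) ≤ 1 := by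
  have := isProbabilityMeasure_mu h0 h1
  simp_rw [← mu_turnEvent h0 h1]
  rw [← measure_biUnion_finset]
  · exact prob_le_one
  · have key : ∀ m m' : ℕ, m < m' → m' ≤ n →
        Disjoint (turnEvent n H m) (turnEvent n H m') := by
      intro m m' hmm hmn
      rw [Set.disjoint_left]
      intro ω hω hω'
      exact not_conn_of_dual_conn (by omega) (by omega : (m : ℤ) < m') (by omega) hω'.1 hω.2.1
        hω.2.2
    intro m hm m' hm' hne
    simp only [Finset.coe_range, Set.mem_Iio] at hm hm'
    rcases Nat.lt_or_gt_of_ne hne with h | h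
    · exact key _ _ h (by omega)
    · exact (key _ _ h (by omega)).symm
  · intro m _
    exact (detBy_turnEvent n H m).measurableSet_of_finite
      ((finite_within (finite_rect _ _)).union (finite_cross n H m))

lemma reflTransGen_right {F : Set Edge} {ω : Config} {x y : ℤ} (k : ℕ)
    (h : ∀ i : ℕ, i < k → ((x + i, y), false) ∈ F ∧ ω ((x + i, y), false) = true) :
    ReflTransGen (stp F ω) (x, y) (x + k, y) := by
  induction k with
  | zero => simp [ReflTransGen.refl]
  | succ k ih =>
    obtain ⟨h1, h2⟩ := h k (by omega)
    refine (ih fun i hi => h i (by omega)).tail ⟨_, h1, Or.inl ⟨rfl, ?_, h2⟩⟩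
    simp [eDst, add_assoc]

lemma reflTransGen_up {F : Set Edge} {ω : Config} {x y : ℤ} (k : ℕ)
    (h : ∀ i : ℕ, i < k → ((x, y + i), true) ∈ F ∧ ω ((x, y + i), true) = true) :
    ReflTransGen (stp F ω) (x, y) (x, y + k) := by
  induction k with
  | zero => simp [ReflTransGen.refl]
  | succ k ih =>
    obtain ⟨h1, h2⟩ := h k (by omega)
    refine (ih fun i hi => h i (by omega)).tail ⟨_, h1, Or.inl ⟨rfl, ?_, h2⟩⟩
    simp [eDst, add_assoc]

lemma reflTransGen_down {F : Set Edge} {ω : Config} {x y : ℤ} (k : ℕ)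
    (h : ∀ i : ℕ, i < k → ((x, y + i), true) ∈ F ∧ ω ((x, y + i), true) = false) :
    ReflTransGen (stp F ω) (x, y + k) (x, y) := by
  induction k with
  | zero => simp [ReflTransGen.refl]
  | succ k ih =>
    obtain ⟨h1, h2⟩ := h k (by omega)
    refine .head ⟨_, h1, Or.inr ⟨rfl, ?_, h2⟩⟩ (ih fun i hi => h i (by omega))
    simp [eDst, add_assoc]

lemma mu_cylinder (h0 : 0 ≤ q) (h1 : q ≤ 1) (F : Finset Edge) (τ : Edge → Bool) :
    mu q {ω | ∀ e ∈ F, ω e = τ e} = ∏ e ∈ F, ber q {τ e} := by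
  have := isProbabilityMeasure_ber h0 h1
  rw [mu_eq_infinitePi h0 h1, ← Measure.infinitePi_pi _ fun _ _ => MeasurableSet.of_discrete]
  congr 1

/-- The columns `n - N + 1, …, n + 1` of height `N`. -/
def strip (N n : ℤ) : Set (ℤ × ℤ) := {v | n - N < v.1 ∧ v.1 ≤ n + 1 ∧ 0 ≤ v.2 ∧ v.2 < N}

lemma finite_strip (N n : ℤ) : (strip N n).Finite :=
  ((Set.finite_Icc (n - N) (n + 1)).prod (Set.finite_Icc 0 N)).subset fun _ hv =>
    ⟨⟨hv.1.le, hv.2.1⟩, ⟨hv.2.2.1, hv.2.2.2.le⟩⟩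

/-- All edges inside the strip point rightwards or downwards. -/
def stripEvent (N n : ℤ) : Set Config := {ω | ∀ e ∈ within (strip N n), ω e = !e.2}

lemma detBy_stripEvent (N n : ℤ) : DetBy (within (strip N n)) (stripEvent N n) :=
  fun _ _ h hω e he => (h e he).symm.trans (hω e he)

lemma mu_stripEvent_zero_ne_zero (h0 : 0 < q) (h1 : q < 1) (N : ℤ) :
    mu q (stripEvent N 0) ≠ 0 := by
  have hf := finite_within (finite_strip N 0)
  have : stripEvent N 0 = {ω | ∀ e ∈ hf.toFinset, ω e = !e.2} := by
    simp [stripEvent]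
  rw [this, mu_cylinder h0.le h1.le hf.toFinset fun e => !e.2, Finset.prod_ne_zero_iff]
  rintro ⟨_, _ | _⟩ - <;> simp [ber_apply, h0, h1]

lemma mu_stripEvent_zero_le (h0 : 0 ≤ q) (h1 : q ≤ 1) (N n : ℤ) :
    mu q (stripEvent N 0) ≤ mu q (stripEvent N n) := by
  have hφ : Function.Injective fun e : Edge => (((e.1.1 + n, e.1.2), e.2) : Edge) := by
    rintro ⟨⟨x, y⟩, b⟩ ⟨⟨x', y'⟩, b'⟩ h
    simpa using h
  rw [← mu_reindex h0 h1 hφ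
    ((detBy_stripEvent N 0).measurableSet_of_finite (finite_within (finite_strip N 0)))]
  refine measure_mono fun ω hω => ?_
  rintro ⟨⟨x, y⟩, b⟩ he
  have := hω ((x - n, y), b) (by
    cases b <;> simp [within, strip, eSrc, eDst] at he ⊢ <;> omega)
  simpa using this

lemma hit_inter_stripEvent_subset {N n H : ℤ} (hN : N ≤ n) (hH : n ≤ H) :
    Conn (hitEdges N n) {(0, 0)} (block N n) ∩ stripEvent N n ⊆
      Conn (within (rect (n + 1) H)) {(0, 0)} {(n + 1, 0)} := by
  rintro ω ⟨⟨_, rfl, ⟨x, y⟩, hb, hab⟩, hω⟩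
  have hsub : hitEdges N n ⊆ within (rect (n + 1) H) :=
    Set.sdiff_subset.trans (within_mono fun v hv => by
      simp only [rect, Set.mem_ofPred_eq] at hv ⊢
      omega)
  have hstrip : within (strip N n) ⊆ within (rect (n + 1) H) := within_mono fun v hv => by
    simp only [rect, strip, Set.mem_ofPred_eq] at hv ⊢
    omega
  simp only [block, Set.mem_ofPred_eq] at hb
  refine ⟨_, rfl, _, rfl, (reflTransGen_stp_mono hsub hab).trans ?_⟩
  refine reflTransGen_stp_mono hstrip ?_
  have hr := reflTransGen_right (F := within (strip N n)) (ω := ω) (x := x) (y := y)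
    (n + 1 - x).toNat fun i hi => by
      have : (((x + i, y), false) : Edge) ∈ within (strip N n) := by
        simp only [within, strip, eSrc, eDst, Set.mem_ofPred_eq, Bool.false_eq_true, if_false]
        omega
      exact ⟨this, hω _ this⟩
  have hd := reflTransGen_down (F := within (strip N n)) (ω := ω) (x := n + 1) (y := 0)
    y.toNat fun i hi => by
      have : (((n + 1, 0 + i), true) : Edge) ∈ within (strip N n) := by
        simp only [within, strip, eSrc, eDst, Set.mem_ofPred_eq, if_true]
        omega
      exact ⟨this, hω _ this⟩
  rw [Int.toNat_of_nonneg (by omega)] at hr hd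
  rw [show x + (n + 1 - x) = n + 1 by ring] at hr
  rw [zero_add] at hd
  exact hr.trans hd

lemma mu_hit_mul_le (h0 : 0 ≤ q) (h1 : q ≤ 1) {N n H : ℤ} (hN : N ≤ n) (hH : n ≤ H) :
    mu q (Conn (hitEdges N n) {(0, 0)} (block N n)) * mu q (stripEvent N 0) ≤
      mu q (Conn (within (rect (n + 1) H)) {(0, 0)} {(n + 1, 0)}) := by
  refine (mul_le_mul_right (mu_stripEvent_zero_le h0 h1 N n) _).trans ?_
  rw [← mu_inter_of_finite h0 h1 (finite_hitEdges N n) (finite_within (finite_strip N n)) ?_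
    (detBy_conn _ _ _) (detBy_stripEvent N n)]
  · exact measure_mono (hit_inter_stripEvent_subset hN hH)
  · rw [Set.disjoint_left]
    rintro e ⟨he, he'⟩ hs
    refine he' ⟨?_, ?_⟩
    · have := he.1
      have := hs.1
      simp only [rect, strip, block, Set.mem_ofPred_eq] at *
      omega
    · have := he.2
      have := hs.2
      simp only [rect, strip, block, Set.mem_ofPred_eq] at *
      omega

/-- The origin is unlikely to be connected to a corner block of fixed size in `[0, n]²`, for
arbitrarily large `n`. -/
lemma exists_mu_hit_le (h0 : 0 < q) (h1 : q < 1) {N k : ℕ} (hk : N ≤ k) {ε : ℝ≥0∞} (hε : ε ≠ 0) :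
    ∃ n : ℕ, k ≤ n ∧ mu q (Conn (hitEdges N n) {(0, 0)} (block N n)) ≤ ε := by
  by_contra! hc
  set δ := ε * mu q (stripEvent N 0) with hδ
  have hδ0 : δ ≠ 0 := mul_ne_zero hε (mu_stripEvent_zero_ne_zero h0 h1 N)
  have hle : ∀ (m : ℕ) (H : ℤ), k + 1 ≤ m → (m : ℤ) ≤ H →
      δ ≤ mu q (Conn (within (rect m H)) {(0, 0)} {((m : ℤ), 0)}) := by
    intro m H hm hH
    obtain ⟨m, rfl⟩ : ∃ i, m = i + 1 := ⟨m - 1, by omega⟩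
    push_cast at hH ⊢
    exact (mul_le_mul_left (hc m (by omega)).le _).trans
      (mu_hit_mul_le h0.le h1.le (by omega) (by omega))
  have hκ : δ * (ENNReal.ofReal (1 - q) * δ) ≠ 0 := by
    have : ENNReal.ofReal (1 - q) ≠ 0 := by simpa using h1
    exact mul_ne_zero hδ0 (mul_ne_zero this hδ0)
  obtain ⟨j, hj⟩ := ENNReal.exists_nat_mul_gt hκ ENNReal.one_ne_top
  refine hj.not_ge (le_trans ?_
    (sum_mu_conn_mul_le_one h0.le h1.le (2 * (k + 1) + j) (2 * (k + 1) + j)))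
  have hsub : Finset.Ico (k + 1) (k + 1 + j) ⊆ Finset.range (2 * (k + 1) + j + 1) := fun m hm => by
    rw [Finset.mem_Ico] at hm
    exact Finset.mem_range.2 (by omega)
  refine le_trans ?_ (Finset.sum_le_sum_of_subset hsub)
  calc (j : ℝ≥0∞) * (δ * (ENNReal.ofReal (1 - q) * δ))
      = ∑ m ∈ Finset.Ico (k + 1) (k + 1 + j), δ * (ENNReal.ofReal (1 - q) * δ) := by simp
    _ ≤ _ := by
      refine Finset.sum_le_sum fun m hm => ?_
      rw [Finset.mem_Ico] at hm
      refine mul_le_mul' (hle m _ hm.1 (by omega)) (mul_le_mul_right ?_ _)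
      rw [← Nat.cast_sub (by omega)]
      exact hle _ _ (by omega) (by omega)

lemma hPos_horizontal (ω : Config) (x y : ℤ) :
    hPos ω ((x, y), false) ↔ ω ((x, y), false) = decide (0 ≤ x) := by
  have : x ^ 2 + y ^ 2 < (x + 1) ^ 2 + y ^ 2 ↔ 0 ≤ x := by
    constructor <;> intro h <;> nlinarith
  simp [hPos, normSq, eSrc, eDst, this]

lemma hPos_vertical (ω : Config) (x y : ℤ) :
    hPos ω ((x, y), true) ↔ ω ((x, y), true) = decide (0 ≤ y) := by
  have : x ^ 2 + y ^ 2 < x ^ 2 + (y + 1) ^ 2 ↔ 0 ≤ y := by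
    constructor <;> intro h <;> nlinarith
  simp [hPos, normSq, eSrc, eDst, this]

/-- Rotation of coded dual vertices by a quarter turn around the origin. -/
def rotVertex (d : ℤ × ℤ) : ℤ × ℤ := (-d.2 - 1, d.1)

/-- Rotation of edges by a quarter turn around the origin. -/
def rotEdge (e : Edge) : Edge :=
  if e.2 then ((-e.1.2 - 1, e.1.1), false) else ((-e.1.2, e.1.1), true)

lemma rotEdge_injective : Function.Injective rotEdge := by
  rintro ⟨⟨x, y⟩, _ | _⟩ ⟨⟨x', y'⟩, _ | _⟩ h <;> simp [rotEdge] at h ⊢ <;> omega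

lemma dualStep_rot {ω : Config} {d d' : ℤ × ℤ} (h : dualStep (fun e => ω (rotEdge e)) d d') :
    dualStep ω (rotVertex d) (rotVertex d') := by
  obtain ⟨a, b⟩ := d
  obtain ⟨a', b'⟩ := d'
  simp only [dualStep, rotVertex, hPos_horizontal, hPos_vertical, rotEdge, Prod.mk.injEq, if_true,
    if_false, Bool.false_eq_true] at h ⊢
  rcases h with ⟨⟨rfl, rfl⟩, h⟩ | ⟨⟨rfl, rfl⟩, h⟩ | ⟨⟨rfl, rfl⟩, h⟩ | ⟨⟨rfl, rfl⟩, h⟩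
  · refine Or.inr (Or.inr (Or.inl ⟨by simp, ?_⟩))
    rw [h]
    simp
    omega
  · refine Or.inr (Or.inr (Or.inr ⟨by simp, ?_⟩))
    rw [Bool.eq_not_of_ne h, ← decide_not]
    simp
    omega
  · refine Or.inr (Or.inl ⟨by omega, ?_⟩)
    rw [show -(b + 1) - 1 + 1 = -(b + 1) by ring]
    exact h
  · refine Or.inl ⟨by omega, ?_⟩
    rw [show -(b' + 1) - 1 + 1 = -(b' + 1) by ring]
    exact h

section Concat

variable {V : Type*} {R : V → V → Prop}

lemma exists_path_of_reflTransGen {a b : V} (h : ReflTransGen R a b) :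
    ∃ (γ : ℕ → V) (k : ℕ), γ 0 = a ∧ γ k = b ∧ ∀ i < k, R (γ i) (γ (i + 1)) := by
  induction h with
  | refl => exact ⟨fun _ => a, 0, rfl, rfl, by simp⟩
  | @tail b c _ hbc ih =>
    obtain ⟨γ, k, h0, hk, h⟩ := ih
    refine ⟨fun i => if i ≤ k then γ i else c, k + 1, by simpa, by simp, fun i hi => ?_⟩
    rcases Nat.lt_succ_iff_lt_or_eq.1 hi with hi | rfl
    · simp only [hi.le, Nat.succ_le_of_lt hi, if_true]
      exact h i hi
    · simpa [hk] using hbc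

lemma exists_concat {γ γ' : ℕ → V} {L L' : ℕ} (h : γ L = γ' 0)
    (hγ : ∀ i < L, R (γ i) (γ (i + 1))) (hγ' : ∀ i < L', R (γ' i) (γ' (i + 1))) :
    ∃ δ : ℕ → V, (∀ i ≤ L, δ i = γ i) ∧ (∀ j, δ (L + j) = γ' j) ∧
      ∀ i < L + L', R (δ i) (δ (i + 1)) := by
  have h1 : ∀ i ≤ L, (if i ≤ L then γ i else γ' (i - L)) = γ i := fun i hi => if_pos hi
  have h2 : ∀ j, (if L + j ≤ L then γ (L + j) else γ' (L + j - L)) = γ' j := by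
    rintro (_ | j)
    · simpa using h
    · simp
  refine ⟨fun i => if i ≤ L then γ i else γ' (i - L), h1, h2, fun i hi => ?_⟩
  rcases lt_or_ge i L with hL | hL
  · have := hγ i hL
    rwa [← h1 i hL.le, ← h1 (i + 1) hL] at this
  · obtain ⟨j, rfl⟩ := Nat.exists_eq_add_of_le hL
    have := hγ' j (by omega)
    rwa [← h2 j, ← h2 (j + 1), ← add_assoc] at this

end Concat

/-- A directed dual path in the annulus `Λ_{n+1} \ Λ_N` from `(n, 0)` to `(-1, n)` that lies in
the NE quadrant up to its last vertex. -/
def IsArc (N n : ℕ) (ω : Config) (γ : ℕ → ℤ × ℤ) (k : ℕ) : Prop :=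
  γ 0 = ((n : ℤ), 0) ∧ γ (k + 1) = (-1, (n : ℤ)) ∧
    (∀ i < k + 1, dualStep ω (γ i) (γ (i + 1))) ∧
    ∀ i ≤ k, dualNE (γ i) ∧ inBox (n + 1) (γ i) ∧ ¬inBox N (γ i)

/-- The event guaranteeing a dual arc through the NE quadrant. -/
def arcEvent (N n : ℤ) : Set Config :=
  {ω | (fun e => !ω (crossEdge n e)) ∈ Conn (within (dom N n)) {(0, 0)} {(n, n)}} ∩
    {ω | ω ((0, n), true) = false}

/-- The edges that determine `arcEvent`. -/
def arcEdges (N n : ℤ) : Set Edge := crossEdge n '' within (dom N n) ∪ {((0, n), true)}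

lemma finite_arcEdges (N n : ℤ) : (arcEdges N n).Finite :=
  ((finite_within (finite_dom N n)).image _).union (Set.finite_singleton _)

lemma detBy_arcEvent (N n : ℤ) : DetBy (arcEdges N n) (arcEvent N n) :=
  ((detBy_conn _ _ _).reindex _ _).inter (detBy_apply _ _)

lemma mu_arcEvent {p : ℝ} (h0 : 0 ≤ p) (h1 : p ≤ 1) (N n : ℤ) :
    mu p (arcEvent N n) = mu (1 - p) (Conn (within (dom N n)) {(0, 0)} {(n, n)}) *
      ENNReal.ofReal (1 - p) := by
  have hf := finite_within (finite_dom N n)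
  rw [arcEvent, mu_inter_of_finite h0 h1 (hf.image _) (Set.finite_singleton _) ?_
    ((detBy_conn _ _ _).reindex _ _) (detBy_apply _ _), mu_apply_false h0 h1,
    mu_reindex_not h0 h1 (crossEdge_injective n) ((detBy_conn _ _ _).measurableSet_of_finite hf)]
  rw [Set.disjoint_right]
  rintro _ rfl ⟨⟨⟨x, y⟩, _ | _⟩, he, h⟩
  · simp [crossEdge, within, dom, rect, eSrc, eDst] at h he
    omega
  · simp [crossEdge] at h

lemma dualStep_of_stp {n H : ℤ} {ω : Config} {x y x' y' : ℤ}
    (h : stp (within (rect n H)) (fun e => !ω (crossEdge n e)) (x, y) (x', y')) :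
    dualStep ω (n - x, y) (n - x', y') := by
  have hmem := h.mem
  simp only [rect, Set.mem_ofPred_eq] at hmem
  simp only [dualStep, hPos_horizontal, hPos_vertical]
  rcases stp_within_rect h with ⟨rfl, rfl, hb⟩ | ⟨rfl, rfl, hb⟩ | ⟨rfl, rfl, hb⟩ |
    ⟨rfl, rfl, hb⟩ <;> simp [crossEdge] at hb
  · refine Or.inr (Or.inl ⟨by ext; exacts [by ring, rfl], ?_⟩)
    rw [show n - (x + 1) + 1 = n - x by ring, hb]
    simp
    omega
  · refine Or.inr (Or.inr (Or.inl ⟨rfl, ?_⟩))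
    rw [hb]
    simp
    omega
  · refine Or.inl ⟨by ext; exacts [by ring, rfl], ?_⟩
    rw [show n - (x' + 1) + 1 = n - x' by ring, hb]
    simp
    omega
  · refine Or.inr (Or.inr (Or.inr ⟨rfl, ?_⟩))
    rw [hb]
    simp
    omega

lemma exists_isArc {N n : ℕ} (hN : N ≤ n) {ω : Config} (h : ω ∈ arcEvent N n) :
    ∃ γ k, IsArc N n ω γ k := by
  obtain ⟨⟨_, rfl, _, rfl, hc⟩, hf⟩ := h
  obtain ⟨g, k, hg0, hgk, hg⟩ := exists_path_of_reflTransGen hc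
  have hdom : ∀ i ≤ k, g i ∈ dom N n := by
    rintro (_ | i) hi
    · rw [hg0]
      simp only [dom, rect, block, Set.mem_sdiff, Set.mem_ofPred_eq]
      omega
    · exact (hg i (by omega)).mem.2
  obtain ⟨δ, hδ, hδ', hstep⟩ := exists_concat (R := dualStep ω)
    (γ := fun i => ((n : ℤ) - (g i).1, (g i).2)) (L := k) (L' := 1)
    (γ' := fun j => if j = 0 then ((0 : ℤ), (n : ℤ)) else (-1, (n : ℤ))) (by simp [hgk])
    (fun i hi => dualStep_of_stp ((hg i hi).mono (within_mono Set.sdiff_subset)))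
    (fun i hi => by
      obtain rfl : i = 0 := by omega
      refine Or.inr (Or.inl ⟨by simp, ?_⟩)
      rw [hPos_vertical]
      have : ω ((0, (n : ℤ)), true) = false := hf
      simp [this])
  refine ⟨δ, k, ?_, ?_, hstep, fun i hi => ?_⟩
  · rw [hδ 0 (Nat.zero_le _), hg0]
    simp
  · rw [hδ' 1]
    simp
  · have := hdom i hi
    rw [hδ i hi]
    simp only [dom, rect, block, Set.mem_sdiff, Set.mem_ofPred_eq, dualNE, inBox, Nat.cast_add,
      Nat.cast_one] at this ⊢
    omega

lemma inBox_rotVertex (m : ℕ) (d : ℤ × ℤ) : inBox m (rotVertex d) ↔ inBox m d := by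
  simp only [inBox, rotVertex]
  omega

/-- The rotation of a configuration. -/
def rotConfig (ω : Config) : Config := fun e => ω (rotEdge e)

lemma bocircuit_of_arcs {N n : ℕ} {ω : Config} {γ₀ γ₁ γ₂ γ₃ : ℕ → ℤ × ℤ} {k₀ k₁ k₂ k₃ : ℕ}
    (h₀ : IsArc N n ω γ₀ k₀) (h₁ : IsArc N n (rotConfig ω) γ₁ k₁)
    (h₂ : IsArc N n (rotConfig (rotConfig ω)) γ₂ k₂)
    (h₃ : IsArc N n (rotConfig (rotConfig (rotConfig ω))) γ₃ k₃) :
    BOcircuit N (n + 1) n ω := by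
  obtain ⟨s₀, e₀, st₀, m₀⟩ := h₀
  obtain ⟨s₁, e₁, st₁, m₁⟩ := h₁
  obtain ⟨s₂, e₂, st₂, m₂⟩ := h₂
  obtain ⟨s₃, e₃, st₃, m₃⟩ := h₃
  obtain ⟨δ₂, a₂, b₂, c₂⟩ := exists_concat (R := dualStep ω) (L := k₂ + 1) (L' := k₃ + 1)
    (γ := fun i => rotVertex (rotVertex (γ₂ i)))
    (γ' := fun i => rotVertex (rotVertex (rotVertex (γ₃ i)))) (by simp [e₂, s₃, rotVertex])
    (fun i hi => dualStep_rot (dualStep_rot (st₂ i hi)))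
    (fun i hi => dualStep_rot (dualStep_rot (dualStep_rot (st₃ i hi))))
  obtain ⟨δ₁, a₁, b₁, c₁⟩ := exists_concat (R := dualStep ω) (L := k₁ + 1)
    (γ := fun i => rotVertex (γ₁ i)) (γ' := δ₂)
    (by rw [a₂ 0 (Nat.zero_le _)]; simp [e₁, s₂, rotVertex])
    (fun i hi => dualStep_rot (st₁ i hi)) c₂
  obtain ⟨δ, a₀, b₀, c₀⟩ := exists_concat (R := dualStep ω) (L := k₀ + 1) (γ := γ₀) (γ' := δ₁)
    (by rw [a₁ 0 (Nat.zero_le _)]; simp [e₀, s₁, rotVertex]) st₀ c₁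
  have f₀ : ∀ i ≤ k₀, δ i = γ₀ i := fun i hi => a₀ i (by omega)
  have f₁ : ∀ j ≤ k₁, δ (k₀ + 1 + j) = rotVertex (γ₁ j) := fun j hj => by
    rw [b₀, a₁ j (by omega)]
  have f₂ : ∀ j ≤ k₂, δ (k₀ + 1 + (k₁ + 1 + j)) = rotVertex (rotVertex (γ₂ j)) := fun j hj => by
    rw [b₀, b₁, a₂ j (by omega)]
  have f₃ : ∀ j, δ (k₀ + 1 + (k₁ + 1 + (k₂ + 1 + j))) =
      rotVertex (rotVertex (rotVertex (γ₃ j))) := fun j => by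
    rw [b₀, b₁, b₂]
  have hend : δ (k₀ + 1 + (k₁ + 1 + (k₂ + 1 + (k₃ + 1)))) = ((n : ℤ), 0) := by
    rw [f₃, e₃]
    simp [rotVertex]
  have hstart : δ 0 = ((n : ℤ), 0) := by rw [f₀ 0 (Nat.zero_le _), s₀]
  refine ⟨δ, k₀ + 1 + (k₁ + 1 + (k₂ + 1 + (k₃ + 1))), k₀, k₀ + 1 + k₁, k₀ + 1 + (k₁ + 1 + k₂),
    by omega, by omega, by omega, hstart, hend, c₀, fun i hi => ?_, fun i hi => ?_,
    fun i hi hi' => ?_, fun i hi hi' => ?_, fun i hi hi' => ?_⟩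
  · rcases Nat.lt_or_ge k₀ i with h | h
    swap
    · rw [f₀ i h]
      exact (m₀ i h).2
    obtain ⟨i, rfl⟩ := Nat.exists_eq_add_of_le (Nat.succ_le_of_lt h)
    rcases Nat.lt_or_ge k₁ i with h | h
    swap
    · rw [Nat.succ_eq_add_one, f₁ i h, inBox_rotVertex, inBox_rotVertex]
      exact (m₁ i h).2
    obtain ⟨i, rfl⟩ := Nat.exists_eq_add_of_le (Nat.succ_le_of_lt h)
    rcases Nat.lt_or_ge k₂ i with h | h
    swap
    · rw [Nat.succ_eq_add_one, Nat.succ_eq_add_one, f₂ i h]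
      simpa only [inBox_rotVertex] using (m₂ i h).2
    obtain ⟨i, rfl⟩ := Nat.exists_eq_add_of_le (Nat.succ_le_of_lt h)
    rcases Nat.lt_or_ge k₃ i with h | h
    · obtain rfl : i = k₃ + 1 := by omega
      rw [Nat.succ_eq_add_one, Nat.succ_eq_add_one, Nat.succ_eq_add_one, hend, ← s₀]
      exact (m₀ 0 (Nat.zero_le _)).2
    · rw [Nat.succ_eq_add_one, Nat.succ_eq_add_one, Nat.succ_eq_add_one, f₃ i]
      simpa only [inBox_rotVertex] using (m₃ i h).2
  · rw [f₀ i hi]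
    exact (m₀ i hi).1
  · obtain ⟨j, rfl⟩ := Nat.exists_eq_add_of_le (Nat.succ_le_of_lt hi)
    have := (m₁ j (by omega)).1
    rw [Nat.succ_eq_add_one, f₁ j (by omega)]
    simp only [dualNE, dualNW, rotVertex] at this ⊢
    omega
  · obtain ⟨j, rfl⟩ : ∃ j, i = k₀ + 1 + (k₁ + 1 + j) := ⟨i - (k₀ + 1 + (k₁ + 1)), by omega⟩
    have := (m₂ j (by omega)).1
    rw [f₂ j (by omega)]
    simp only [dualNE, dualSW, rotVertex] at this ⊢
    omega
  · obtain ⟨j, rfl⟩ : ∃ j, i = k₀ + 1 + (k₁ + 1 + (k₂ + 1 + j)) :=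
      ⟨i - (k₀ + 1 + (k₁ + 1 + (k₂ + 1))), by omega⟩
    have := (m₃ j (by omega)).1
    rw [f₃ j]
    simp only [dualNE, dualSE, rotVertex] at this ⊢
    omega

/-- The edges of the NE quadrant, including those of the upper vertical half-axis. -/
def edgesNE : Set Edge := {e | 0 ≤ e.1.1 ∧ 0 ≤ e.1.2 ∧ (e.2 = false → 1 ≤ e.1.2)}

lemma arcEdges_subset {N n : ℤ} (hn : 0 ≤ n) : arcEdges N n ⊆ edgesNE := by
  rintro _ (⟨⟨⟨x, y⟩, _ | _⟩, he, rfl⟩ | rfl)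
  · simp [crossEdge, within, dom, rect, eSrc, eDst, edgesNE] at he ⊢
    omega
  · simp [crossEdge, within, dom, rect, eSrc, eDst, edgesNE] at he ⊢
    omega
  · simp [edgesNE, hn]

lemma disjoint_edgesNE : Disjoint edgesNE
    (rotEdge '' (edgesNE ∪ rotEdge '' (edgesNE ∪ rotEdge '' edgesNE))) := by
  rw [Set.disjoint_left]
  rintro _ he ⟨_, he₁ | ⟨_, he₂ | ⟨⟨⟨x, y⟩, _ | _⟩, he₃, rfl⟩, rfl⟩, rfl⟩
  · rename_i e
    rcases e with ⟨⟨x, y⟩, _ | _⟩ <;> simp [edgesNE, rotEdge] at * <;> omega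
  · rename_i e
    rcases e with ⟨⟨x, y⟩, _ | _⟩ <;> simp [edgesNE, rotEdge] at * <;> omega
  · simp [edgesNE, rotEdge] at * ; omega
  · simp [edgesNE, rotEdge] at * ; omega

lemma mu_inter_rot {p : ℝ} (h0 : 0 ≤ p) (h1 : p ≤ 1) {F G : Set Edge} (hF : F.Finite)
    (hG : G.Finite) (hd : Disjoint F (rotEdge '' G)) {A B : Set Config} (hA : DetBy F A)
    (hB : DetBy G B) : mu p (A ∩ rotConfig ⁻¹' B) = mu p A * mu p B := by
  rw [← mu_reindex h0 h1 rotEdge_injective (hB.measurableSet_of_finite hG)]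
  exact mu_inter_of_finite h0 h1 hF (hG.image _) hd hA (hB.reindex rotEdge id)

lemma pow_le_mu_bocircuit {p : ℝ} (h0 : 0 ≤ p) (h1 : p ≤ 1) {N n : ℕ} (hN : N ≤ n) :
    (mu (1 - p) (Conn (within (dom N n)) {(0, 0)} {((n : ℤ), (n : ℤ))}) *
      ENNReal.ofReal (1 - p)) ^ 4 ≤ mu p {ω | BOcircuit N (n + 1) n ω} := by
  rw [← mu_arcEvent h0 h1]
  set A := arcEvent N n with hA
  set F := arcEdges N n with hF
  have hFs : F ⊆ edgesNE := arcEdges_subset (by omega)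
  have hfin : F.Finite := finite_arcEdges N n
  have hdet : DetBy F A := detBy_arcEvent N n
  have hfin₂ : (F ∪ rotEdge '' F).Finite := hfin.union (hfin.image _)
  have hfin₃ : (F ∪ rotEdge '' (F ∪ rotEdge '' F)).Finite := hfin.union (hfin₂.image _)
  have hdet₂ : DetBy (F ∪ rotEdge '' F) (A ∩ rotConfig ⁻¹' A) :=
    hdet.inter (hdet.reindex rotEdge id)
  have hdet₃ : DetBy (F ∪ rotEdge '' (F ∪ rotEdge '' F))
      (A ∩ rotConfig ⁻¹' (A ∩ rotConfig ⁻¹' A)) := hdet.inter (hdet₂.reindex rotEdge id)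
  have hd₃ : Disjoint F (rotEdge '' (F ∪ rotEdge '' (F ∪ rotEdge '' F))) :=
    disjoint_edgesNE.mono hFs (by gcongr)
  have hd₂ : Disjoint F (rotEdge '' (F ∪ rotEdge '' F)) :=
    hd₃.mono_right (Set.image_mono (Set.union_subset_union_right _
      (Set.image_mono Set.subset_union_left)))
  have hd₁ : Disjoint F (rotEdge '' F) :=
    hd₂.mono_right (Set.image_mono Set.subset_union_left)
  calc mu p A ^ 4 = mu p A * (mu p A * (mu p A * mu p A)) := by ring
    _ = mu p (A ∩ rotConfig ⁻¹' (A ∩ rotConfig ⁻¹' (A ∩ rotConfig ⁻¹' A))) := by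
      rw [mu_inter_rot h0 h1 hfin hfin₃ hd₃ hdet hdet₃,
        mu_inter_rot h0 h1 hfin hfin₂ hd₂ hdet hdet₂, mu_inter_rot h0 h1 hfin hfin hd₁ hdet hdet]
    _ ≤ _ := by
      refine measure_mono ?_
      rintro ω ⟨w₀, w₁, w₂, w₃⟩
      obtain ⟨γ₀, k₀, a₀⟩ := exists_isArc hN w₀
      obtain ⟨γ₁, k₁, a₁⟩ := exists_isArc hN w₁
      obtain ⟨γ₂, k₂, a₂⟩ := exists_isArc hN w₂
      obtain ⟨γ₃, k₃, a₃⟩ := exists_isArc hN w₃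
      exact bocircuit_of_arcs a₀ a₁ a₂ a₃

lemma thetaNE_zero : thetaNE 0 = 0 := by
  have hsub : {ω | percolates (gStep ω) NEquad} ⊆
      {ω : Config | ω ((0, 0), false) = true} ∪ {ω : Config | ω ((0, 0), true) = true} := by
    rintro ω ⟨γ, h0, -, hstep, hq⟩
    have h1 := hq 1
    obtain ⟨⟨⟨x, y⟩, b⟩, ⟨hs, hd, hb⟩ | ⟨hs, hd, hb⟩⟩ := hstep 0
    · rw [h0] at hs
      obtain ⟨rfl, rfl⟩ : x = 0 ∧ y = 0 := by simpa [eSrc] using hs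
      cases b
      · exact Or.inl hb
      · exact Or.inr hb
    · rw [h0] at hd
      rw [zero_add] at hs
      rw [← hs] at h1
      cases b <;> simp [eSrc, eDst, NEquad] at hd h1 <;> omega
  refine measure_mono_null hsub (measure_union_null ?_ ?_) <;>
    simp [mu_apply_true le_rfl zero_le_one]

lemma mu_one_conn_dom {N n : ℕ} (hN : N ≤ n) :
    mu 1 (Conn (within (dom N n)) {(0, 0)} {((n : ℤ), (n : ℤ))}) = 1 := by
  have := isProbabilityMeasure_mu zero_le_one (le_refl (1 : ℝ))
  have hf := finite_within (finite_dom N n)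
  refine le_antisymm prob_le_one ?_
  have h1 : mu 1 {ω | ∀ e ∈ hf.toFinset, ω e = true} = 1 := by
    rw [mu_cylinder zero_le_one le_rfl hf.toFinset fun _ => true]
    simp [ber_apply]
  rw [← h1]
  refine measure_mono fun ω hω => ?_
  replace hω : ∀ e ∈ within (dom N n), ω e = true := fun e he => hω e (hf.mem_toFinset.2 he)
  have hup := reflTransGen_up (F := within (dom N n)) (ω := ω) (x := 0) (y := 0) n fun i hi => by
    have : (((0, 0 + i), true) : Edge) ∈ within (dom N n) := by
      simp only [within, dom, rect, block, eSrc, eDst, Set.mem_sdiff, Set.mem_ofPred_eq, if_true]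
      omega
    exact ⟨this, hω _ this⟩
  have hr := reflTransGen_right (F := within (dom N n)) (ω := ω) (x := 0) (y := n) n
    fun i hi => by
      have : (((0 + i, n), false) : Edge) ∈ within (dom N n) := by
        simp only [within, dom, rect, block, eSrc, eDst, Set.mem_sdiff, Set.mem_ofPred_eq,
          Bool.false_eq_true, if_false]
        omega
      exact ⟨this, hω _ this⟩
  rw [zero_add] at hup hr
  exact ⟨_, rfl, _, rfl, hup.trans hr⟩

lemma thetaNE_le_one {q : ℝ} (h0 : 0 ≤ q) (h1 : q ≤ 1) : thetaNE q ≤ 1 := by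
  have := isProbabilityMeasure_mu h0 h1
  exact prob_le_one

lemma exists_sq_thetaNE_le {q : ℝ} (h0 : 0 ≤ q) (h1 : q ≤ 1) (hθ : 0 < thetaNE q) (N : ℕ) :
    ∃ n : ℕ, N ≤ n ∧ ENNReal.ofReal (9 / 20 * (thetaNE q).toReal) ^ 2 ≤
      mu q (Conn (within (dom N n)) {(0, 0)} {((n : ℤ), (n : ℤ))}) := by
  have hle := thetaNE_le_one h0 h1
  have hne : thetaNE q ≠ ⊤ := ne_top_of_le_ne_top ENNReal.one_ne_top hle
  rcases h0.eq_or_lt with rfl | h0'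
  · simp [thetaNE_zero] at hθ
  rcases h1.eq_or_lt with rfl | h1'
  · refine ⟨N, le_rfl, ?_⟩
    rw [mu_one_conn_dom le_rfl]
    refine pow_le_one₀ zero_le ?_
    rw [ENNReal.ofReal_le_one]
    have := ENNReal.toReal_mono ENNReal.one_ne_top hle
    rw [ENNReal.toReal_one] at this
    linarith
  have hε : ENNReal.ofReal ((thetaNE q).toReal / 20) ≠ 0 := by
    have := ENNReal.toReal_pos hθ.ne' hne
    rw [Ne, ENNReal.ofReal_eq_zero]
    linarith
  obtain ⟨n, hn, hhit⟩ := exists_mu_hit_le h0' h1' (Nat.le_succ N) hε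
  refine ⟨n, by omega, le_trans ?_ (sq_mu_out_le h0 h1 (by omega))⟩
  gcongr
  have := isProbabilityMeasure_mu h0 h1
  have key := thetaNE_le h0 h1 (N := N) (n := n) (by omega) (by omega)
  refine ENNReal.ofReal_le_of_le_toReal ?_
  have h2 := ENNReal.toReal_mono (by finiteness) key
  have h3 := ENNReal.toReal_mono (by finiteness) hhit
  rw [ENNReal.toReal_ofReal (by positivity)] at h3
  rw [ENNReal.toReal_mul, ENNReal.toReal_add (by finiteness) (by finiteness)] at h2
  simp only [ENNReal.toReal_ofNat] at h2
  linarith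

/-- If `θ = θ_NE(1-p) > 0`, then for each `N > 0` there is `M > N` such that for
some `A ∈ [N, M]` the probability that the closed circuit event `B^O(A, A)`
occurs inside `Λ_M \ Λ_N` is strictly greater than `(1/9) (θ(1-p)/2)⁸`. -/
theorem exists_BOcircuit_prob_gt (p : ℝ) (hp0 : 0 ≤ p) (hp1 : p ≤ 1)
    (hθ : 0 < thetaNE (1 - p)) (N : ℕ) (hN : 0 < N) :
    ∃ M a : ℕ, N < M ∧ N ≤ a ∧ a ≤ M ∧
      (thetaNE (1 - p) * ENNReal.ofReal (1 - p) / 2) ^ 8 / 9 <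
        mu p {ω | BOcircuit N M a ω} := by
  have h0 : 0 ≤ 1 - p := by linarith
  have h1 : 1 - p ≤ 1 := by linarith
  obtain ⟨n, hn, hc⟩ := exists_sq_thetaNE_le h0 h1 hθ N
  refine ⟨n + 1, n, by omega, hn, by omega, ?_⟩
  refine lt_of_lt_of_le ?_ (pow_le_mu_bocircuit hp0 hp1 hn)
  refine lt_of_lt_of_le ?_ (pow_le_pow_left' (mul_le_mul_left hc _) 4)
  have hne : thetaNE (1 - p) ≠ ⊤ :=
    ne_top_of_le_ne_top ENNReal.one_ne_top (thetaNE_le_one h0 h1)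
  have ht := ENNReal.toReal_pos hθ.ne' hne
  have hq : 0 < 1 - p := by
    refine h0.lt_of_ne fun h => ?_
    rw [← h, thetaNE_zero] at hθ
    exact hθ.ne rfl
  nth_rewrite 1 [← ENNReal.ofReal_toReal hne]
  generalize (thetaNE (1 - p)).toReal = t at ht
  generalize 1 - p = q at h1 hq
  have e1 : (ENNReal.ofReal t * ENNReal.ofReal q / 2) ^ 8 / 9 =
      ENNReal.ofReal ((t * q / 2) ^ 8 / 9) := by
    rw [ENNReal.ofReal_div_of_pos (by norm_num), ENNReal.ofReal_pow (by positivity),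
      ENNReal.ofReal_div_of_pos (by norm_num), ENNReal.ofReal_mul ht.le]
    simp
  have e2 : (ENNReal.ofReal (9 / 20 * t) ^ 2 * ENNReal.ofReal q) ^ 4 =
      ENNReal.ofReal (((9 / 20 * t) ^ 2 * q) ^ 4) := by
    rw [ENNReal.ofReal_pow (by positivity),
      ENNReal.ofReal_mul (p := (9 / 20 * t) ^ 2) (by positivity),
      ENNReal.ofReal_pow (by positivity)]
  rw [e1, e2, ENNReal.ofReal_lt_ofReal_iff (by positivity)]
  have h8 : q ^ 8 ≤ q ^ 4 := pow_le_pow_of_le_one hq.le h1 (by norm_num)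
  have hq4 : 0 < q ^ 4 := by positivity
  have ht8 : 0 < t ^ 8 := by positivity
  calc (t * q / 2) ^ 8 / 9 = t ^ 8 * (q ^ 8 * (1 / 2304)) := by ring
    _ < t ^ 8 * (q ^ 4 * (9 / 20) ^ 8) := by
      gcongr ?_ * ?_
      linarith
    _ = _ := by ring

end RandomOrientation
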